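/- arXiv:0809.4246 — 9 statements merged into one kernel-verified Lean document; each statement's English description precedes it below -/
import Mathlib

section
/- Let V : I × (-ε, ε) → E be a smooth map on an open interval I such that for each s ∈ (-ε, ε) the curve t ↦ V(t, s) is a geodesic of G. Set c(t) = V(t, 0) and J(t) = ∂_s V(t, s)|_{s=0}. Then J is a Jacobi field along the geodesic c, i.e. J''(t) = -2·DG(c(t), c'(t))·(J(t), J'(t)) for all t ∈ I. -/
open Set

section PartialDerivatives

variable {E : Type*} [NormedAddCommGroup E] [NormedSpace ℝ E] {V : ℝ → ℝ → E} {U : Set (ℝ × ℝ)}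

theorem hasDerivAt_fst_of_hasFDerivAt {F : ℝ × ℝ → E} {F' : ℝ × ℝ →L[ℝ] E} {t s : ℝ}
    (h : HasFDerivAt F F' (t, s)) : HasDerivAt (fun u => F (u, s)) (F' (1, 0)) t :=
  h.comp_hasDerivAt t ((hasDerivAt_id t).prodMk (hasDerivAt_const t s))

theorem hasDerivAt_snd_of_hasFDerivAt {F : ℝ × ℝ → E} {F' : ℝ × ℝ →L[ℝ] E} {t s : ℝ}
    (h : HasFDerivAt F F' (t, s)) : HasDerivAt (fun r => F (t, r)) (F' (0, 1)) s :=
  h.comp_hasDerivAt s ((hasDerivAt_const s t).prodMk (hasDerivAt_id s))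

theorem ContDiffOn.hasFDerivAt_uncurry (hU : IsOpen U)
    (hV : ContDiffOn ℝ (⊤ : ℕ∞) (fun p : ℝ × ℝ => V p.1 p.2) U) {p : ℝ × ℝ} (hp : p ∈ U) :
    HasFDerivAt (fun p : ℝ × ℝ => V p.1 p.2) (fderiv ℝ (fun p : ℝ × ℝ => V p.1 p.2) p) p :=
  ((hV.contDiffAt (hU.mem_nhds hp)).differentiableAt (by simp)).hasFDerivAt

theorem ContDiffOn.deriv_fst (hU : IsOpen U)
    (hV : ContDiffOn ℝ (⊤ : ℕ∞) (fun p : ℝ × ℝ => V p.1 p.2) U) :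
    ContDiffOn ℝ (⊤ : ℕ∞) (fun p : ℝ × ℝ => deriv (fun u => V u p.2) p.1) U :=
  ((hV.fderiv_of_isOpen hU (by simp)).clm_apply contDiffOn_const).congr fun _ hp =>
    (hasDerivAt_fst_of_hasFDerivAt (hV.hasFDerivAt_uncurry hU hp)).deriv

theorem deriv_deriv_comm (hU : IsOpen U)
    (hV : ContDiffOn ℝ (⊤ : ℕ∞) (fun p : ℝ × ℝ => V p.1 p.2) U) {t s : ℝ} (hp : (t, s) ∈ U) :
    deriv (fun u => deriv (fun r => V u r) s) t = deriv (fun r => deriv (fun u => V u r) t) s := by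
  set F : ℝ × ℝ → E := fun p => V p.1 p.2
  have hsymm : IsSymmSndFDerivAt ℝ F (t, s) :=
    (hV.contDiffAt (hU.mem_nhds hp)).isSymmSndFDerivAt
      (by rw [minSmoothness_of_isRCLikeNormedField]; exact WithTop.coe_le_coe.2 (le_top : (2 : ℕ∞) ≤ ⊤))
  have hF' : HasFDerivAt (fderiv ℝ F) (fderiv ℝ (fderiv ℝ F) (t, s)) (t, s) :=
    (((hV.fderiv_of_isOpen (m := 1) hU (by norm_cast)).contDiffAt
      (hU.mem_nhds hp)).differentiableAt (by simp)).hasFDerivAt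
  have h₁ : (fun u => deriv (fun r => V u r) s) =ᶠ[nhds t] fun u => fderiv ℝ F (u, s) (0, 1) := by
    have hc : ContinuousAt (fun u : ℝ => (u, s)) t := by fun_prop
    filter_upwards [hc (hU.mem_nhds hp)] with u hu
    exact (hasDerivAt_snd_of_hasFDerivAt (hV.hasFDerivAt_uncurry hU hu)).deriv
  have h₂ : (fun r => deriv (fun u => V u r) t) =ᶠ[nhds s] fun r => fderiv ℝ F (t, r) (1, 0) := by
    have hc : ContinuousAt (fun r : ℝ => (t, r)) s := by fun_prop
    filter_upwards [hc (hU.mem_nhds hp)] with r hr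
    exact (hasDerivAt_fst_of_hasFDerivAt (hV.hasFDerivAt_uncurry hU hr)).deriv
  have e₁ : HasDerivAt (fun u => fderiv ℝ F (u, s) (0, 1))
      (fderiv ℝ (fderiv ℝ F) (t, s) (1, 0) (0, 1)) t := by
    simpa using (hasDerivAt_fst_of_hasFDerivAt hF').clm_apply (hasDerivAt_const t ((0, 1) : ℝ × ℝ))
  have e₂ : HasDerivAt (fun r => fderiv ℝ F (t, r) (1, 0))
      (fderiv ℝ (fderiv ℝ F) (t, s) (0, 1) (1, 0)) s := by
    simpa using (hasDerivAt_snd_of_hasFDerivAt hF').clm_apply (hasDerivAt_const s ((1, 0) : ℝ × ℝ))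
  rw [h₁.deriv_eq, h₂.deriv_eq, e₁.deriv, e₂.deriv]
  exact hsymm _ _

end PartialDerivatives

/-- If `V : I × (-ε, ε) → E` is a smooth geodesic variation of the geodesic
`c(t) = V(t, 0)` for the spray with coefficients `G`, then `J(t) = ∂ₛ V(t,s)|₀` is a Jacobi
field along `c`: it satisfies `J'' = -2 · DG(c, c')·(J, J')`, the coordinate form of the
geodesic equation of the complete lift `S^c`. -/
theorem geodesic_variation_gives_jacobi_field
    {E : Type*} [NormedAddCommGroup E] [NormedSpace ℝ E] [FiniteDimensional ℝ E] [Nontrivial E]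
    (G : E × E → E)
    (hGsmooth : ContDiffOn ℝ (⊤ : ℕ∞) G {p : E × E | p.2 ≠ 0})
    (hGhom : ∀ (x y : E) (l : ℝ), 0 < l → y ≠ 0 → G (x, l • y) = l ^ 2 • G (x, y))
    (I : Set ℝ) (hIopen : IsOpen I) (hIconn : I.OrdConnected)
    (ε : ℝ) (hε : 0 < ε)
    (V : ℝ → ℝ → E)
    (hVsmooth : ContDiffOn ℝ (⊤ : ℕ∞) (fun p : ℝ × ℝ => V p.1 p.2) (I ×ˢ Ioo (-ε) ε))
    (hVgeo : ∀ s ∈ Ioo (-ε) ε, ∀ t ∈ I,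
      deriv (fun u => V u s) t ≠ 0 ∧
      deriv (deriv (fun u => V u s)) t = (-2 : ℝ) • G (V t s, deriv (fun u => V u s) t)) :
    ∀ t ∈ I,
      deriv (deriv (fun u => deriv (fun s => V u s) 0)) t
        = (-2 : ℝ) • fderiv ℝ G (V t 0, deriv (fun u => V u 0) t)
            (deriv (fun s => V t s) 0, deriv (fun u => deriv (fun s => V u s) 0) t) := by
  intro t ht
  have hU : IsOpen (I ×ˢ Ioo (-ε) ε) := hIopen.prod isOpen_Ioo
  have h0 : (0 : ℝ) ∈ Ioo (-ε) ε := ⟨by linarith, hε⟩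
  have hW := hVsmooth.deriv_fst hU
  have hJ' : ∀ u ∈ I, deriv (fun u => deriv (fun s => V u s) 0) u
      = deriv (fun s => deriv (fun u => V u s) u) 0 :=
    fun u hu => deriv_deriv_comm hU hVsmooth ⟨hu, h0⟩
  have hJ'' : deriv (fun u => deriv (fun u => deriv (fun s => V u s) 0) u) t
      = deriv (fun u => deriv (fun s => deriv (fun u => V u s) u) 0) t := by
    refine Filter.EventuallyEq.deriv_eq ?_
    filter_upwards [hIopen.mem_nhds ht] with u hu using hJ' u hu
  have hswap : deriv (fun u => deriv (fun s => deriv (fun u => V u s) u) 0) t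
      = deriv (fun s => deriv (fun u => deriv (fun u => V u s) u) t) 0 :=
    deriv_deriv_comm (V := fun t s => deriv (fun u => V u s) t) hU hW ⟨ht, h0⟩
  have hgeo : (fun s => deriv (fun u => deriv (fun u => V u s) u) t)
      =ᶠ[nhds 0] fun s => (-2 : ℝ) • G (V t s, deriv (fun u => V u s) t) := by
    filter_upwards [isOpen_Ioo.mem_nhds h0] with s hs using (hVgeo s hs t ht).2
  have hVs : HasDerivAt (fun s => V t s) (deriv (fun s => V t s) 0) 0 :=
    (hasDerivAt_snd_of_hasFDerivAt
      (hVsmooth.hasFDerivAt_uncurry hU ⟨ht, h0⟩)).differentiableAt.hasDerivAt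
  have hWs : HasDerivAt (fun s => deriv (fun u => V u s) t)
      (deriv (fun s => deriv (fun u => V u s) t) 0) 0 :=
    (hasDerivAt_snd_of_hasFDerivAt
      (ContDiffOn.hasFDerivAt_uncurry (V := fun t s => deriv (fun u => V u s) t)
        hU hW ⟨ht, h0⟩)).differentiableAt.hasDerivAt
  have hopen : IsOpen {p : E × E | p.2 ≠ 0} := isOpen_ne_fun continuous_snd continuous_const
  have hG : HasFDerivAt G (fderiv ℝ G (V t 0, deriv (fun u => V u 0) t))
      (V t 0, deriv (fun u => V u 0) t) :=
    ((hGsmooth.contDiffAt (hopen.mem_nhds (hVgeo 0 h0 t ht).1)).differentiableAt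
      (by simp)).hasFDerivAt
  rw [hJ' t ht]
  exact hJ''.trans (hswap.trans (hgeo.deriv_eq.trans
    ((hG.comp_hasDerivAt (0 : ℝ) (hVs.prodMk hWs)).const_smul (-2 : ℝ)).deriv))
end

section
/- Let x : I → E be a geodesic of G on an open interval I containing the compact interval [0, L], and let J be a Jacobi field along x. Then there exist ε > 0 and a smooth map V : [0, L] × (-ε, ε) → E such that for each s ∈ (-ε, ε) the curve t ↦ V(t, s) is the restriction of a geodesic of G, V(t, 0) = x(t) for all t ∈ [0, L], and ∂_s V(t, s)|_{s=0} = J(t) for all t ∈ [0, L]. (Every Jacobi field on a compact interval arises from a geodesic variation.) -/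
open Set

universe u

section Superposition

open scoped ContDiff

variable {K : Type*} [TopologicalSpace K] [CompactSpace K]

/-- Pointwise application of a continuous family of continuous linear maps to a continuous map. -/
noncomputable def ContinuousMap.pointwiseApply {Z W : Type*} [NormedAddCommGroup Z]
    [NormedSpace ℝ Z] [NormedAddCommGroup W] [NormedSpace ℝ W] :
    C(K, Z →L[ℝ] W) →L[ℝ] C(K, Z) →L[ℝ] C(K, W) :=
  LinearMap.mkContinuous₂
    (LinearMap.mk₂ ℝ (fun (A : C(K, Z →L[ℝ] W)) (η : C(K, Z)) =>
        (⟨fun t => A t (η t), by fun_prop⟩ : C(K, W)))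
      (fun _ _ _ => by ext; simp) (fun _ _ _ => by ext; simp)
      (fun _ _ _ => by ext; simp) (fun _ _ _ => by ext; simp))
    1 (fun A η => by
      rw [one_mul, ContinuousMap.norm_le _ (by positivity)]
      intro t
      exact ((A t).le_opNorm _).trans
        (mul_le_mul (A.norm_coe_le_norm t) (η.norm_coe_le_norm t) (by positivity)
          (by positivity)))

@[simp]
theorem ContinuousMap.pointwiseApply_apply {Z W : Type*} [NormedAddCommGroup Z]
    [NormedSpace ℝ Z] [NormedAddCommGroup W] [NormedSpace ℝ W]
    (A : C(K, Z →L[ℝ] W)) (η : C(K, Z)) (t : K) :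
    ContinuousMap.pointwiseApply A η t = A t (η t) := rfl

theorem ContinuousMap.hasFDerivAt_postcomp {Z W : Type*} [NormedAddCommGroup Z]
    [NormedSpace ℝ Z] [NormedAddCommGroup W] [NormedSpace ℝ W] (F : C(Z, W)) (F' : C(Z, Z →L[ℝ] W))
    (hF : ∀ z, HasFDerivAt F (F' z) z) (γ : C(K, Z)) :
    HasFDerivAt (fun η : C(K, Z) => F.comp η) (ContinuousMap.pointwiseApply (F'.comp γ)) γ := by
  rw [hasFDerivAt_iff_isLittleO_nhds_zero, Asymptotics.isLittleO_iff]
  intro ε hε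
  obtain ⟨δ, hδ, hball⟩ := (Metric.continuous_iff (α := C(K, Z))
    (β := C(K, Z →L[ℝ] W))).1 F'.continuous_postcomp γ ε hε
  filter_upwards [Metric.ball_mem_nhds (0 : C(K, Z)) hδ] with η hη
  rw [ContinuousMap.norm_le _ (by positivity)]
  intro t
  have hbound : ∀ w ∈ Metric.ball (γ t) δ, ‖F' w - F' (γ t)‖ ≤ ε := by
    intro w hw
    have h1 : dist (γ + ContinuousMap.const K (w - γ t)) γ < δ := by
      rw [dist_eq_norm, add_sub_cancel_left]
      refine lt_of_le_of_lt ((ContinuousMap.norm_le _ (norm_nonneg (w - γ t))).2 ?_)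
        (mem_ball_iff_norm.1 hw)
      intro s
      simp
    have h2 := (ContinuousMap.dist_apply_le_dist t).trans (hball _ h1).le
    simpa [dist_eq_norm] using h2
  have hmem : γ t + η t ∈ Metric.ball (γ t) δ := by
    rw [mem_ball_iff_norm, add_sub_cancel_left]
    exact (η.norm_coe_le_norm t).trans_lt (mem_ball_zero_iff.1 hη)
  have h := (convex_ball (γ t) δ).norm_image_sub_le_of_norm_hasFDerivWithin_le'
    (fun w _ => (hF w).hasFDerivWithinAt) hbound (Metric.mem_ball_self hδ) hmem
  rw [add_sub_cancel_left] at h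
  exact h.trans (mul_le_mul_of_nonneg_left (η.norm_coe_le_norm t) hε.le)

theorem ContinuousMap.contDiff_nat_postcomp {Z : Type u} [NormedAddCommGroup Z] [NormedSpace ℝ Z]
    (n : ℕ) : ∀ {W : Type u} [NormedAddCommGroup W] [NormedSpace ℝ W] (F : C(Z, W)),
      ContDiff ℝ n F → ContDiff ℝ n (fun η : C(K, Z) => F.comp η) := by
  induction n with
  | zero =>
    intro W _ _ F _
    exact contDiff_zero.2 F.continuous_postcomp
  | succ n ih =>
    intro W _ _ F hF
    push_cast at hF ⊢
    obtain ⟨F', hF', hd⟩ := contDiff_succ_iff_hasFDerivAt.1 hF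
    let A : C(Z, Z →L[ℝ] W) := ⟨F', hF'.continuous⟩
    have hA : ContDiff ℝ n fun γ : C(K, Z) => ContinuousMap.pointwiseApply (A.comp γ) :=
      ContinuousLinearMap.contDiff _ |>.comp (ih A hF')
    exact contDiff_succ_iff_hasFDerivAt.2
      ⟨fun γ => ContinuousMap.pointwiseApply (A.comp γ),
        hA, ContinuousMap.hasFDerivAt_postcomp F A hd⟩

theorem ContinuousMap.contDiff_postcomp {Z : Type*} [NormedAddCommGroup Z] [NormedSpace ℝ Z]
    (F : C(Z, Z)) (hF : ContDiff ℝ ∞ F) : ContDiff ℝ ∞ (fun η : C(K, Z) => F.comp η) :=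
  contDiff_infty.2 fun n => ContinuousMap.contDiff_nat_postcomp n F (contDiff_infty.1 hF n)

end Superposition

section Volterra

open intervalIntegral unitInterval

variable {Z : Type u} [NormedAddCommGroup Z]

/-- The extension of a continuous map on the unit interval by its end values. -/
noncomputable abbrev unitExtend (η : C(I, Z)) (r : ℝ) : Z := η (projIcc 0 1 zero_le_one r)

theorem continuous_unitExtend (η : C(I, Z)) : Continuous (unitExtend η) :=
  η.continuous.comp continuous_projIcc

variable [NormedSpace ℝ Z]

/-- The Volterra integration operator `η ↦ (τ ↦ ∫ r in 0..τ, η r)` on the unit interval. -/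
noncomputable def volterra : C(I, Z) →L[ℝ] C(I, Z) :=
  LinearMap.mkContinuous
    { toFun := fun η => ⟨fun τ => ∫ r in (0 : ℝ)..τ, unitExtend η r,
        (continuous_primitive (fun a b => (continuous_unitExtend η).intervalIntegrable a b) 0).comp
          continuous_subtype_val⟩
      map_add' := fun η ζ => by
        ext τ
        exact integral_add ((continuous_unitExtend η).intervalIntegrable _ _)
          ((continuous_unitExtend ζ).intervalIntegrable _ _)
      map_smul' := fun c η => by
        ext τ
        exact integral_smul c _ }
    1 (fun η => by
      rw [one_mul, ContinuousMap.norm_le _ (norm_nonneg _)]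
      intro τ
      refine (norm_integral_le_of_norm_le_const (C := ‖η‖)
        fun r _ => η.norm_coe_le_norm _).trans ?_
      rw [sub_zero, abs_of_nonneg τ.2.1]
      exact mul_le_of_le_one_right (norm_nonneg _) τ.2.2)

theorem volterra_apply (η : C(I, Z)) (τ : I) :
    volterra η τ = ∫ r in (0 : ℝ)..τ, unitExtend η r := rfl

theorem norm_pow_apply_le_of_volterra_bound {A : C(I, Z) →L[ℝ] C(I, Z)} {C : ℝ} (hC : 0 ≤ C)
    (hA : ∀ η τ, ‖A η τ‖ ≤ C * ∫ r in (0 : ℝ)..τ, ‖unitExtend η r‖) (n : ℕ) (η : C(I, Z)) (τ : I) :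
    ‖(A ^ n) η τ‖ ≤ (C * τ) ^ n / n.factorial * ‖η‖ := by
  induction n generalizing τ with
  | zero => simpa using η.norm_coe_le_norm τ
  | succ n ih =>
    rw [pow_succ', mul_apply_eq_comp]
    have hint : ∫ r in (0 : ℝ)..τ, ‖unitExtend ((A ^ n) η) r‖ ≤
        ∫ r in (0 : ℝ)..τ, (C ^ n / n.factorial * ‖η‖) * r ^ n := by
      refine integral_mono_on τ.2.1 ((continuous_unitExtend _).norm.intervalIntegrable _ _)
        ((by fun_prop : Continuous fun r : ℝ =>
          (C ^ n / n.factorial * ‖η‖) * r ^ n).intervalIntegrable _ _) fun r hr => ?_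
      have h := ih (projIcc 0 1 zero_le_one r)
      rw [projIcc_of_mem zero_le_one ⟨hr.1, hr.2.trans τ.2.2⟩] at h
      rw [unitExtend, projIcc_of_mem zero_le_one ⟨hr.1, hr.2.trans τ.2.2⟩]
      refine h.trans_eq ?_
      rw [mul_pow]
      ring
    refine (hA _ τ).trans ((mul_le_mul_of_nonneg_left hint hC).trans_eq ?_)
    rw [integral_const_mul, integral_pow, Nat.factorial_succ]
    push_cast
    field_simp
    ring

theorem isUnit_one_sub_of_volterra_bound [CompleteSpace Z] {A : C(I, Z) →L[ℝ] C(I, Z)} {C : ℝ}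
    (hC : 0 ≤ C) (hA : ∀ η τ, ‖A η τ‖ ≤ C * ∫ r in (0 : ℝ)..τ, ‖unitExtend η r‖) :
    IsUnit (1 - A) := by
  obtain ⟨n, hn⟩ := ((FloorSemiring.tendsto_pow_div_factorial_atTop C).eventually
    (gt_mem_nhds one_pos)).exists
  have hlt : ‖A ^ n‖ < 1 := by
    refine lt_of_le_of_lt (ContinuousLinearMap.opNorm_le_bound _ (by positivity) fun η => ?_) hn
    rw [ContinuousMap.norm_le _ (by positivity)]
    intro τ
    refine (norm_pow_apply_le_of_volterra_bound hC hA n η τ).trans ?_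
    have : C * τ ≤ C := mul_le_of_le_one_right hC τ.2.2
    have : 0 ≤ C * τ := mul_nonneg hC τ.2.1
    gcongr
  have h := isUnit_one_sub_of_norm_lt_one (R := C(I, Z) →L[ℝ] C(I, Z)) hlt
  rw [← mul_neg_geom_sum] at h
  exact ((Commute.isUnit_mul_iff
    ((mul_neg_geom_sum A n).trans (geom_sum_mul_neg A n).symm)).1 h).1

theorem volterra_pointwiseApply_bound (T : ℝ) (M : C(I, Z →L[ℝ] Z)) (η : C(I, Z)) (τ : I) :
    ‖(T • volterra ∘L ContinuousMap.pointwiseApply M) η τ‖ ≤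
      (|T| * ‖M‖) * ∫ r in (0 : ℝ)..τ, ‖unitExtend η r‖ := by
  have h : ‖volterra (ContinuousMap.pointwiseApply M η) τ‖ ≤
      ∫ r in (0 : ℝ)..τ, ‖M‖ * ‖unitExtend η r‖ :=
    norm_integral_le_of_norm_le τ.2.1
      (Filter.Eventually.of_forall fun r _ => ((M _).le_opNorm _).trans
        (mul_le_mul_of_nonneg_right (M.norm_coe_le_norm _) (norm_nonneg _)))
      ((continuous_unitExtend η).norm.const_mul ‖M‖ |>.intervalIntegrable _ _)
  rw [integral_const_mul] at h
  calc ‖(T • volterra ∘L ContinuousMap.pointwiseApply M) η τ‖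
      = |T| * ‖volterra (ContinuousMap.pointwiseApply M η) τ‖ := norm_smul _ _
    _ ≤ _ := by
      rw [mul_assoc]
      exact mul_le_mul_of_nonneg_left h (abs_nonneg _)

theorem isUnit_one_sub_volterra_pointwiseApply [CompleteSpace Z] (T : ℝ) (M : C(I, Z →L[ℝ] Z)) :
    IsUnit (1 - T • volterra ∘L ContinuousMap.pointwiseApply M) :=
  isUnit_one_sub_of_volterra_bound (by positivity) (volterra_pointwiseApply_bound T M)

theorem eq_add_volterra_of_hasDerivAt [CompleteSpace Z] {y : ℝ → Z} {ζ : C(I, Z)}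
    (h : ∀ r (hr : r ∈ Icc (0 : ℝ) 1), HasDerivAt y (ζ ⟨r, hr⟩) r) (τ : I) :
    y τ = y 0 + volterra ζ τ := by
  rw [volterra_apply, integral_eq_sub_of_hasDerivAt (f := y) ?_
    ((continuous_unitExtend ζ).intervalIntegrable _ _), add_sub_cancel]
  intro r hr
  rw [uIcc_of_le τ.2.1] at hr
  have hr' : r ∈ Icc (0 : ℝ) 1 := ⟨hr.1, hr.2.trans τ.2.2⟩
  rw [unitExtend, projIcc_of_mem _ hr']
  exact h r hr'

end Volterra

section Picard

open intervalIntegral unitInterval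
open scoped ContDiff Topology

variable {Z : Type u} [NormedAddCommGroup Z] [NormedSpace ℝ Z]

/-- The map whose zeros `((T, z), γ)` are the solutions `γ` on the unit interval of `γ' = T • F γ`
with `γ 0 = z`. -/
noncomputable def picardMap (F : C(Z, Z)) (p : (ℝ × Z) × C(I, Z)) : C(I, Z) :=
  p.2 - ContinuousLinearMap.const ℝ I p.1.2 - p.1.1 • volterra (F.comp p.2)

theorem picardMap_eq_zero_iff {F : C(Z, Z)} {T : ℝ} {z : Z} {γ : C(I, Z)} :
    picardMap F ((T, z), γ) = 0 ↔ ∀ τ, γ τ = z + T • volterra (F.comp γ) τ := by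
  rw [picardMap, sub_sub, sub_eq_zero, ContinuousMap.ext_iff]
  rfl

theorem contDiff_picardMap {F : C(Z, Z)} (hF : ContDiff ℝ ∞ F) : ContDiff ℝ ∞ (picardMap F) := by
  have h1 : ContDiff ℝ ∞ fun p : (ℝ × Z) × C(I, Z) => volterra (F.comp p.2) :=
    volterra.contDiff.comp ((ContinuousMap.contDiff_postcomp F hF).comp contDiff_snd)
  have hconst : ContDiff ℝ ∞ (fun z : Z => ContinuousLinearMap.const ℝ I z) :=
    ContinuousLinearMap.contDiff _
  have h2 : ContDiff ℝ ∞ fun p : (ℝ × Z) × C(I, Z) => ContinuousLinearMap.const ℝ I p.1.2 :=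
    hconst.comp contDiff_fst.snd
  exact (contDiff_snd.sub h2).sub (contDiff_fst.fst.smul h1)

theorem hasFDerivAt_picardMap_right {F : C(Z, Z)} {F' : C(Z, Z →L[ℝ] Z)}
    (hF : ∀ z, HasFDerivAt F (F' z) z) (u : ℝ × Z) (γ : C(I, Z)) :
    HasFDerivAt (fun η => picardMap F (u, η))
      (1 - u.1 • volterra ∘L ContinuousMap.pointwiseApply (F'.comp γ)) γ := by
  have h : HasFDerivAt (fun η : C(I, Z) => volterra (F.comp η))
      (volterra ∘L ContinuousMap.pointwiseApply (F'.comp γ)) γ :=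
    HasFDerivAt.comp γ (ContinuousLinearMap.hasFDerivAt _)
      (ContinuousMap.hasFDerivAt_postcomp F F' hF γ)
  have h1 : HasFDerivAt (fun η : C(I, Z) => η - ContinuousLinearMap.const ℝ I u.2)
      (1 : C(I, Z) →L[ℝ] C(I, Z)) γ := (hasFDerivAt_id γ).sub_const _
  exact h1.sub (h.const_smul u.1)

theorem isInvertible_fderiv_picardMap [CompleteSpace Z] {F : C(Z, Z)} (hF : ContDiff ℝ ∞ F)
    (p : (ℝ × Z) × C(I, Z)) :
    (fderiv ℝ (picardMap F) p ∘L .inr ℝ (ℝ × Z) C(I, Z)).IsInvertible := by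
  have hF' : ∀ z, HasFDerivAt F ((⟨fderiv ℝ F, hF.continuous_fderiv (by simp)⟩ :
      C(Z, Z →L[ℝ] Z)) z) z :=
    fun z => (hF.differentiable (by simp) z).hasFDerivAt
  have hinr : HasFDerivAt (fun η : C(I, Z) => (p.1, η)) (.inr ℝ (ℝ × Z) C(I, Z)) p.2 :=
    hasFDerivAt_prodMk_right p.1 p.2
  have hd : HasFDerivAt (picardMap F) (fderiv ℝ (picardMap F) p) (p.1, p.2) :=
    ((contDiff_picardMap hF).differentiable (by simp) p).hasFDerivAt
  have h1 := hd.comp p.2 hinr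
  rw [h1.unique (hasFDerivAt_picardMap_right hF' p.1 p.2)]
  obtain ⟨e, he⟩ := isUnit_one_sub_volterra_pointwiseApply p.1.1 (ContinuousMap.comp
    (⟨fderiv ℝ F, hF.continuous_fderiv (by simp)⟩ : C(Z, Z →L[ℝ] Z)) p.2)
  exact ⟨ContinuousLinearEquiv.unitsEquiv ℝ _ e, he⟩

/-- Solutions of `γ' = T • F γ` with `γ 0 = z` depend smoothly on `(T, z)`. -/
theorem exists_contDiffAt_picardMap_eq_zero [CompleteSpace Z] {F : C(Z, Z)} (hF : ContDiff ℝ ∞ F)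
    {u : ℝ × Z} {γ : C(I, Z)} (h : picardMap F (u, γ) = 0) :
    ∃ g : ℝ × Z → C(I, Z), ContDiffAt ℝ ∞ g u ∧ g u = γ ∧
      (∀ᶠ v in 𝓝 u, picardMap F (v, g v) = 0) ∧
      ∀ᶠ q in 𝓝 (u, γ), picardMap F q = 0 → g q.1 = q.2 := by
  have hc : ContDiffAt ℝ ∞ (picardMap F) (u, γ) := (contDiff_picardMap hF).contDiffAt
  have hi := isInvertible_fderiv_picardMap hF (u, γ)
  refine ⟨hc.implicitFunction (by simp) hi, hc.contDiffAt_implicitFunction (by simp) hi,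
    hc.implicitFunction_apply_self (by simp) hi, ?_, ?_⟩
  · simpa only [h] using hc.eventually_apply_implicitFunction (by simp) hi
  · filter_upwards [hc.eventually_apply_eq_iff_implicitFunction (by simp) hi] with q hq h0
    exact hq.1 (h0.trans h.symm)

/-- The map `τ ↦ r * τ` of the unit interval, truncated to the unit interval. -/
noncomputable def unitScale : C(ℝ, C(I, I)) :=
  ContinuousMap.curry ⟨fun p : ℝ × I => projIcc 0 1 zero_le_one (p.1 * p.2),
    continuous_projIcc.comp (by fun_prop)⟩

theorem unitScale_apply (r : ℝ) (τ : I) :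
    unitScale r τ = projIcc 0 1 zero_le_one (r * τ) := rfl

theorem picardMap_unitScale {F : C(Z, Z)} {T : ℝ} {z : Z} {γ : C(I, Z)}
    (h : picardMap F ((T, z), γ) = 0) {r : ℝ} (hr : r ∈ Icc (0 : ℝ) 1) :
    picardMap F ((T * r, z), γ.comp (unitScale r)) = 0 := by
  rw [picardMap_eq_zero_iff] at h ⊢
  intro τ
  have hmem : ∀ s ∈ Icc (0 : ℝ) 1, r * s ∈ Icc (0 : ℝ) 1 := fun s hs =>
    ⟨mul_nonneg hr.1 hs.1, mul_le_one₀ hr.2 hs.1 hs.2⟩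
  rw [ContinuousMap.comp_apply, h, mul_smul, volterra_apply, volterra_apply, unitScale_apply,
    projIcc_of_mem _ (hmem τ τ.2)]
  have h2 := smul_integral_comp_mul_left (a := 0) (b := (τ : ℝ)) (unitExtend (F.comp γ)) r
  rw [mul_zero] at h2
  rw [← h2]
  congr 3
  refine integral_congr fun s hs => ?_
  rw [uIcc_of_le τ.2.1] at hs
  have hs' : s ∈ Icc (0 : ℝ) 1 := ⟨hs.1, hs.2.trans τ.2.2⟩
  simp only [unitExtend, ContinuousMap.comp_apply, unitScale_apply]
  rw [projIcc_of_mem _ hs']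

theorem hasDerivAt_unitExtend_of_picardMap [CompleteSpace Z] {F : C(Z, Z)} {T : ℝ} {z : Z}
    {γ : C(I, Z)} (h : picardMap F ((T, z), γ) = 0) {r : ℝ} (hr : r ∈ Ioo (0 : ℝ) 1) :
    HasDerivAt (unitExtend γ) (T • F (unitExtend γ r)) r := by
  rw [picardMap_eq_zero_iff] at h
  have h1 := ((continuous_unitExtend (F.comp γ)).integral_hasStrictDerivAt 0 r).hasDerivAt
  refine ((h1.const_smul T).const_add z).congr_of_eventuallyEq ?_
  filter_upwards [Ioo_mem_nhds hr.1 hr.2] with s hs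
  rw [unitExtend, h, volterra_apply, projIcc_of_mem _ (Ioo_subset_Icc_self hs)]
  rfl

end Picard

section Variation

open unitInterval
open scoped ContDiff Topology

variable {Z : Type u} [NormedAddCommGroup Z] [NormedSpace ℝ Z]

theorem affine_mem_Icc {a b r : ℝ} (hab : a ≤ b) (hr : r ∈ Icc (0 : ℝ) 1) :
    a + (b - a) * r ∈ Icc a b :=
  ⟨le_add_of_nonneg_right (mul_nonneg (sub_nonneg.2 hab) hr.1),
    by linarith [mul_le_of_le_one_right (sub_nonneg.2 hab) hr.2]⟩

/-- The affine reparametrization by the unit interval of a curve defined on `[a, b]`. -/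
noncomputable def unitReparam {a b : ℝ} (hab : a ≤ b) (y : ℝ → Z) (hy : ContinuousOn y (Icc a b)) :
    C(I, Z) :=
  ⟨fun τ => y (a + (b - a) * τ),
    hy.comp_continuous (by fun_prop) fun τ => affine_mem_Icc hab τ.2⟩

theorem unitReparam_eq_add_volterra [CompleteSpace Z] {a b : ℝ} (hab : a ≤ b) {y : ℝ → Z}
    (hy : ContinuousOn y (Icc a b)) {ζ : C(I, Z)}
    (h : ∀ τ : I, HasDerivAt y (ζ τ) (a + (b - a) * τ)) (τ : I) :
    unitReparam hab y hy τ = y a + (b - a) • volterra ζ τ := by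
  have h1 := eq_add_volterra_of_hasDerivAt (y := fun r => y (a + (b - a) * r))
    (ζ := (b - a) • ζ) (fun r hr => by
      have h2 : HasDerivAt (fun r : ℝ => a + (b - a) * r) (b - a) r := by
        simpa using ((hasDerivAt_id r).const_mul (b - a)).const_add a
      exact (h ⟨r, hr⟩).scomp r h2) τ
  rw [map_smul] at h1
  simpa [unitReparam] using h1

theorem exists_smooth_variation_of_linearization [CompleteSpace Z] {F : C(Z, Z)}
    (hF : ContDiff ℝ ∞ F) {a b : ℝ} (hab : a < b) {z w : ℝ → Z}
    (hz : ∀ t ∈ Icc a b, HasDerivAt z (F (z t)) t)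
    (hw : ∀ t ∈ Icc a b, HasDerivAt w (fderiv ℝ F (z t) (w t)) t)
    {N : Set Z} (hN : IsOpen N) (hzN : ∀ t ∈ Icc a b, z t ∈ N) :
    ∃ ε > (0 : ℝ), ∃ Φ : ℝ → ℝ → Z,
      (∀ t ∈ Ioo a b, ∀ s ∈ Ioo (-ε) ε, ContDiffAt ℝ ∞ (fun p : ℝ × ℝ => Φ p.1 p.2) (t, s) ∧
        HasDerivAt (fun t => Φ t s) (F (Φ t s)) t ∧ Φ t s ∈ N) ∧
      ∀ t ∈ Ioo a b, Φ t 0 = z t ∧ HasDerivAt (fun s => Φ t s) (w t) 0 := by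
  have hT : 0 < b - a := sub_pos.2 hab
  have hzc : ContinuousOn z (Icc a b) := fun t ht => (hz t ht).continuousAt.continuousWithinAt
  have hwc : ContinuousOn w (Icc a b) := fun t ht => (hw t ht).continuousAt.continuousWithinAt
  set γ₀ : C(I, Z) := unitReparam hab.le z hzc with hγ₀
  set κ : C(I, Z) := unitReparam hab.le w hwc with hκ
  have hsol : picardMap F ((b - a, z a), γ₀) = 0 := picardMap_eq_zero_iff.2
    (unitReparam_eq_add_volterra hab.le hzc fun τ => hz _ (affine_mem_Icc hab.le τ.2))
  obtain ⟨g, hg, hg0, hgsol, -⟩ := exists_contDiffAt_picardMap_eq_zero hF hsol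
  set ℓ : ℝ → ℝ × Z := fun s => (b - a, z a + s • w a) with hℓ
  have hℓs : ContDiff ℝ ∞ ℓ := by fun_prop
  have hℓ0 : ℓ 0 = (b - a, z a) := by simp [hℓ]
  set H : ℝ → C(I, Z) := fun s => g (ℓ s) with hH
  have hH0 : H 0 = γ₀ := by rw [hH]; simp only [hℓ0, hg0]
  have hHs : ContDiffAt ℝ ∞ H 0 := ContDiffAt.comp 0 (by rwa [hℓ0]) hℓs.contDiffAt
  have hev : ∀ᶠ s in 𝓝 (0 : ℝ), picardMap F (ℓ s, H s) = 0 := by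
    refine hℓs.continuous.continuousAt.eventually (p := fun v => picardMap F (v, g v) = 0) ?_
    rwa [hℓ0]
  have hcont : ∀ᶠ s in 𝓝 (0 : ℝ), ContinuousAt H s :=
    ((hHs.of_le (m := 1) (by simp)).eventually (by simp)).mono fun s hs => hs.continuousAt
  have hmaps : ∀ᶠ s in 𝓝 (0 : ℝ), ∀ τ, H s τ ∈ N := by
    have hopen : IsOpen {γ : C(I, Z) | MapsTo γ univ N} :=
      ContinuousMap.isOpen_setOfPred_mapsTo isCompact_univ hN
    refine (hHs.continuousAt.eventually (hopen.mem_nhds ?_)).mono fun s hs τ => hs (mem_univ τ)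
    rw [hH0]
    exact fun τ _ => hzN _ (affine_mem_Icc hab.le τ.2)
  obtain ⟨ε, hε, hball⟩ := Metric.eventually_nhds_iff_ball.1 (hev.and (hcont.and hmaps))
  rw [Real.ball_eq_Ioo, zero_sub, zero_add] at hball
  have hratio : ∀ t ∈ Ioo a b, (t - a) / (b - a) ∈ Ioo (0 : ℝ) 1 := fun t ht =>
    ⟨div_pos (sub_pos.2 ht.1) hT, (div_lt_one hT).2 (sub_lt_sub_right ht.2 a)⟩
  have hderivH : HasDerivAt H κ 0 := by
    have hd := (hHs.differentiableAt (by simp)).hasDerivAt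
    set W := deriv H 0 with hW
    let F' : C(Z, Z →L[ℝ] Z) := ⟨fderiv ℝ F, hF.continuous_fderiv (by simp)⟩
    have hF' : ∀ y, HasFDerivAt F (F' y) y := fun y =>
      (hF.differentiable (by simp) y).hasFDerivAt
    have hpost : HasDerivAt (fun s => F.comp (H s))
        (ContinuousMap.pointwiseApply (F'.comp γ₀) W) 0 := by
      have h1 := ContinuousMap.hasFDerivAt_postcomp F F' hF' (H 0)
      rw [hH0] at h1
      exact HasFDerivAt.comp_hasDerivAt_of_eq 0 h1 hd hH0.symm
    have hvolt : HasDerivAt (fun s => volterra (F.comp (H s)))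
        (volterra (ContinuousMap.pointwiseApply (F'.comp γ₀) W)) 0 :=
      HasFDerivAt.comp_hasDerivAt 0 (ContinuousLinearMap.hasFDerivAt _) hpost
    have hinit : HasDerivAt (fun s : ℝ => z a + s • w a) (w a) 0 := by
      simpa using ((hasDerivAt_id (0 : ℝ)).smul_const (w a)).const_add (z a)
    have hconst : HasDerivAt (fun s : ℝ => ContinuousLinearMap.const ℝ I (z a + s • w a))
        (ContinuousLinearMap.const ℝ I (w a)) 0 :=
      HasFDerivAt.comp_hasDerivAt 0 (ContinuousLinearMap.hasFDerivAt _) hinit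
    have hzero := ((hd.sub hconst).sub (hvolt.const_smul (b - a))).unique
      ((hasDerivAt_const (0 : ℝ) (0 : C(I, Z))).congr_of_eventuallyEq hev)
    obtain ⟨e, he⟩ := isUnit_one_sub_volterra_pointwiseApply (b - a) (F'.comp γ₀)
    have h1 : (e : C(I, Z) →L[ℝ] C(I, Z)) W = ContinuousLinearMap.const ℝ I (w a) := by
      rw [he, ← sub_eq_zero, ← hzero]
      exact sub_right_comm _ _ _
    have h2 : (e : C(I, Z) →L[ℝ] C(I, Z)) κ = ContinuousLinearMap.const ℝ I (w a) := by
      rw [he]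
      ext τ
      have h3 := unitReparam_eq_add_volterra hab.le hwc
        (ζ := ContinuousMap.pointwiseApply (F'.comp γ₀) κ)
        (fun τ => hw _ (affine_mem_Icc hab.le τ.2)) τ
      exact sub_eq_of_eq_add h3
    have h3 : W = κ := (ContinuousLinearEquiv.unitsEquiv ℝ _ e).injective (h1.trans h2.symm)
    rwa [h3] at hd
  have hreparam : ∀ (y : ℝ → Z) (hy : ContinuousOn y (Icc a b)), ∀ t ∈ Ioo a b,
      unitExtend (unitReparam hab.le y hy) ((t - a) / (b - a)) = y t := by
    intro y hy t ht
    rw [unitExtend, projIcc_of_mem _ (Ioo_subset_Icc_self (hratio t ht))]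
    simp only [unitReparam, ContinuousMap.coe_mk]
    rw [mul_div_cancel₀ _ hT.ne', add_sub_cancel]
  refine ⟨ε, hε, fun t s => unitExtend (H s) ((t - a) / (b - a)), fun t ht s hs => ⟨?_, ?_, ?_⟩,
    fun t ht => ⟨?_, ?_⟩⟩
  · set ρ : ℝ → ℝ := fun t => (t - a) / (b - a) with hρ
    have hscaled : ∀ t' ∈ Ioo a b, ∀ s' ∈ Ioo (-ε) ε,
        picardMap F ((t' - a, z a + s' • w a), (H s').comp (unitScale (ρ t'))) = 0 := by
      intro t' ht' s' hs'
      have h1 := picardMap_unitScale (hball s' hs').1 (Ioo_subset_Icc_self (hratio t' ht'))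
      rwa [mul_div_cancel₀ _ hT.ne'] at h1
    obtain ⟨k, hk, -, -, hku⟩ := exists_contDiffAt_picardMap_eq_zero hF (hscaled t ht s hs)
    set m : ℝ × ℝ → ℝ × Z := fun p => (p.1 - a, z a + p.2 • w a) with hm
    have hms : ContDiff ℝ ∞ m := by fun_prop
    have hΓ : ContinuousAt (fun p : ℝ × ℝ => (H p.2).comp (unitScale (ρ p.1))) (t, s) :=
      ContinuousAt.compCM
        (ContinuousAt.comp (f := Prod.snd) (x := (t, s)) (hball s hs).2.1 continuousAt_snd)
        (unitScale.continuous.comp (by fun_prop)).continuousAt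
    have hev' : (fun p : ℝ × ℝ => unitExtend (H p.2) (ρ p.1)) =ᶠ[𝓝 (t, s)]
        fun p => ContinuousMap.evalCLM ℝ (1 : I) (k (m p)) := by
      filter_upwards [(hms.continuous.continuousAt.prodMk hΓ).eventually hku,
        prod_mem_nhds (Ioo_mem_nhds ht.1 ht.2) (Ioo_mem_nhds hs.1 hs.2)] with p hp hp'
      have h1 : k (m p) = (H p.2).comp (unitScale (ρ p.1)) := hp (hscaled _ hp'.1 _ hp'.2)
      rw [h1]
      change _ = H p.2 (unitScale (ρ p.1) 1)
      rw [unitScale_apply]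
      simp
    refine ContDiffAt.congr_of_eventuallyEq ?_ hev'
    have hkm : ContDiffAt ℝ ∞ (fun p => k (m p)) (t, s) :=
      ContDiffAt.comp (t, s) hk hms.contDiffAt
    exact ContDiffAt.comp (t, s) (ContinuousLinearMap.contDiff _).contDiffAt hkm
  · have h1 := hasDerivAt_unitExtend_of_picardMap (hball s hs).1 (hratio t ht)
    have h2 : HasDerivAt (fun t : ℝ => (t - a) / (b - a)) (1 / (b - a)) t :=
      ((hasDerivAt_id t).sub_const a).div_const (b - a)
    have h3 := h1.scomp t h2
    rwa [smul_smul, one_div, inv_mul_cancel₀ hT.ne', one_smul] at h3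
  · exact (hball s hs).2.2 _
  · simp only [hH0]
    exact hreparam z hzc t ht
  · have h1 : HasDerivAt
        (fun s => ContinuousMap.evalCLM ℝ (projIcc 0 1 zero_le_one ((t - a) / (b - a))) (H s))
        (ContinuousMap.evalCLM ℝ (projIcc 0 1 zero_le_one ((t - a) / (b - a))) κ) 0 :=
      HasFDerivAt.comp_hasDerivAt 0 (ContinuousLinearMap.hasFDerivAt _) hderivH
    rw [← hreparam w hwc t ht]
    exact h1

end Variation

open scoped ContDiff Topology Manifold in
theorem exists_contDiff_eqOn_nhds_of_isCompact {Z : Type*} [NormedAddCommGroup Z]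
    [NormedSpace ℝ Z] [FiniteDimensional ℝ Z] {W : Type*} [NormedAddCommGroup W] [NormedSpace ℝ W]
    {U K : Set Z} (hU : IsOpen U) (hK : IsCompact K) (hKU : K ⊆ U) {f : Z → W}
    (hf : ContDiffOn ℝ ∞ f U) :
    ∃ g : Z → W, ContDiff ℝ ∞ g ∧ ∃ N, IsOpen N ∧ K ⊆ N ∧ N ⊆ U ∧ EqOn g f N := by
  have : ProperSpace Z := FiniteDimensional.proper ℝ Z
  obtain ⟨V, hV, hKV, hVU, -⟩ := exists_open_between_and_isCompact_closure hK hU hKU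
  obtain ⟨χ, hχ1, hχ0, -⟩ := exists_contMDiffMap_one_nhds_of_subset_interior (n := ⊤) 𝓘(ℝ, Z)
    hK.isClosed (hKV.trans hV.interior_eq.superset)
  have hχ : ContDiff ℝ ∞ χ := χ.contMDiff.contDiff
  obtain ⟨N, hN, hKN, hN1⟩ := mem_nhdsSet_iff_exists.1 hχ1
  refine ⟨fun p => χ p • f p, contDiff_iff_contDiffAt.2 fun p => ?_, N ∩ U, hN.inter hU,
    subset_inter hKN hKU, inter_subset_right, fun p hp => ?_⟩
  · by_cases hp : p ∈ closure V
    · exact hχ.contDiffAt.smul (hf.contDiffAt (hU.mem_nhds (hVU hp)))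
    · refine (contDiffAt_const (c := (0 : W))).congr_of_eventuallyEq ?_
      filter_upwards [isClosed_closure.isOpen_compl.mem_nhds hp] with q hq
      rw [hχ0 q fun h => hq (subset_closure h), zero_smul]
  · have h1 : χ p = 1 := hN1 hp.1
    simp only [h1, one_smul]

theorem exists_Icc_subset_of_isOpen {I : Set ℝ} (hI : IsOpen I) (hc : I.OrdConnected) {c d : ℝ}
    (hcd : c ≤ d) (h : Icc c d ⊆ I) : ∃ a < c, ∃ b > d, Icc a b ⊆ I := by
  obtain ⟨l, hl, hlI⟩ := exists_Ioc_subset_of_mem_nhds (hI.mem_nhds (h (left_mem_Icc.2 hcd)))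
    (exists_lt c)
  obtain ⟨u, hu, huI⟩ := exists_Ico_subset_of_mem_nhds (hI.mem_nhds (h (right_mem_Icc.2 hcd)))
    (exists_gt d)
  obtain ⟨a, ha1, ha2⟩ := exists_between hl
  obtain ⟨b, hb1, hb2⟩ := exists_between hu
  exact ⟨a, ha2, b, hb1, hc.out (hlI ⟨ha1, ha2.le⟩) (huI ⟨hb1.le, hb2⟩)⟩

theorem hasDerivAt_prodMk_deriv {E : Type*} [NormedAddCommGroup E] [NormedSpace ℝ E] {I : Set ℝ}
    (hI : IsOpen I) {y : ℝ → E} (hy : ContDiffOn ℝ (⊤ : ℕ∞) y I) {t : ℝ} (ht : t ∈ I) :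
    HasDerivAt (fun t => (y t, deriv y t)) (deriv y t, deriv (deriv y) t) t := by
  have h1 : DifferentiableAt ℝ y t :=
    (hy.differentiableOn (by simp)).differentiableAt (hI.mem_nhds ht)
  have h2 : DifferentiableAt ℝ (deriv y) t :=
    ((hy.deriv_of_isOpen (m := 1) hI (by norm_cast)).differentiableOn (by simp)).differentiableAt
      (hI.mem_nhds ht)
  exact h1.hasDerivAt.prodMk h2.hasDerivAt

/-- Every Jacobi field on a compact interval `[0, L]` arises from a geodesic
variation: if `x` is a geodesic of the spray with coefficients `G` on an open interval
`I ⊇ [0, L]` and `J` is a Jacobi field along `x`, then there are `ε > 0` and a smooth map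
`V : [0, L] × (-ε, ε) → E` whose `s`-slices are restrictions of geodesics of `G`, with
`V(t, 0) = x(t)` and `∂ₛ V(t, s)|₀ = J(t)` on `[0, L]`. -/
theorem jacobi_field_from_geodesic_variation
    {E : Type*} [NormedAddCommGroup E] [NormedSpace ℝ E] [FiniteDimensional ℝ E] [Nontrivial E]
    (G : E × E → E)
    (hGsmooth : ContDiffOn ℝ (⊤ : ℕ∞) G {p : E × E | p.2 ≠ 0})
    (hGhom : ∀ (x y : E) (l : ℝ), 0 < l → y ≠ 0 → G (x, l • y) = l ^ 2 • G (x, y))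
    (I : Set ℝ) (hIopen : IsOpen I) (hIconn : I.OrdConnected)
    (L : ℝ) (hL : 0 < L) (hIcc : Icc 0 L ⊆ I)
    (x : ℝ → E)
    (hxsmooth : ContDiffOn ℝ (⊤ : ℕ∞) x I)
    (hxreg : ∀ t ∈ I, deriv x t ≠ 0)
    (hxgeo : ∀ t ∈ I, deriv (deriv x) t = (-2 : ℝ) • G (x t, deriv x t))
    (J : ℝ → E)
    (hJsmooth : ContDiffOn ℝ (⊤ : ℕ∞) J I)
    (hJjac : ∀ t ∈ I,
      deriv (deriv J) t = (-2 : ℝ) • fderiv ℝ G (x t, deriv x t) (J t, deriv J t)) :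
    ∃ ε > (0 : ℝ), ∃ V : ℝ → ℝ → E,
      ContDiffOn ℝ (⊤ : ℕ∞) (fun p : ℝ × ℝ => V p.1 p.2) (Icc 0 L ×ˢ Ioo (-ε) ε) ∧
      (∀ s ∈ Ioo (-ε) ε, ∃ (I' : Set ℝ) (c : ℝ → E),
        IsOpen I' ∧ I'.OrdConnected ∧ Icc 0 L ⊆ I' ∧
        ContDiffOn ℝ (⊤ : ℕ∞) c I' ∧
        (∀ t ∈ I', deriv c t ≠ 0) ∧
        (∀ t ∈ I', deriv (deriv c) t = (-2 : ℝ) • G (c t, deriv c t)) ∧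
        (∀ t ∈ Icc 0 L, V t s = c t)) ∧
      (∀ t ∈ Icc 0 L, V t 0 = x t) ∧
      (∀ t ∈ Icc 0 L, deriv (fun s => V t s) 0 = J t) := by
  obtain ⟨a, ha, b, hb, habI⟩ := exists_Icc_subset_of_isOpen hIopen hIconn hL.le hIcc
  have hab : a < b := ha.trans (hL.trans hb)
  have hsub : Icc 0 L ⊆ Ioo a b := fun t ht => ⟨ha.trans_le ht.1, ht.2.trans_lt hb⟩
  set U : Set (E × E) := {p : E × E | p.2 ≠ 0} with hU
  have hUo : IsOpen U := isOpen_ne_fun continuous_snd continuous_const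
  set f : E × E → E × E := fun p => (p.2, (-2 : ℝ) • G p) with hf
  have hfs : ContDiffOn ℝ (⊤ : ℕ∞) f U := contDiffOn_snd.prodMk (hGsmooth.const_smul (-2 : ℝ))
  set z : ℝ → E × E := fun t => (x t, deriv x t) with hz
  set w : ℝ → E × E := fun t => (J t, deriv J t) with hw
  have hzd : ∀ t ∈ I, HasDerivAt z (f (z t)) t := fun t ht => by
    have h := hasDerivAt_prodMk_deriv hIopen hxsmooth ht
    rwa [hxgeo t ht] at h
  have hzU : ∀ t ∈ I, z t ∈ U := hxreg
  have hK : IsCompact (z '' Icc a b) := isCompact_Icc.image_of_continuousOn fun t ht =>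
    (hzd t (habI ht)).continuousAt.continuousWithinAt
  obtain ⟨g, hg, N, hN, hKN, hNU, hgf⟩ := exists_contDiff_eqOn_nhds_of_isCompact hUo hK
    (image_subset_iff.2 fun t ht => hzU t (habI ht)) hfs
  have hzN : ∀ t ∈ Icc a b, z t ∈ N := fun t ht => hKN (mem_image_of_mem z ht)
  have hfd : ∀ p ∈ N, ∀ v : E × E, fderiv ℝ g p v = (v.2, (-2 : ℝ) • fderiv ℝ G p v) := by
    intro p hp v
    have hG : HasFDerivAt G (fderiv ℝ G p) p :=
      ((hGsmooth.differentiableOn (by simp)).differentiableAt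
        (hUo.mem_nhds (hNU hp))).hasFDerivAt
    have h : HasFDerivAt f
        ((ContinuousLinearMap.snd ℝ E E).prod ((-2 : ℝ) • fderiv ℝ G p)) p :=
      hasFDerivAt_snd.prodMk (hG.const_smul (-2 : ℝ))
    rw [(h.congr_of_eventuallyEq (hgf.eventuallyEq_of_mem (hN.mem_nhds hp))).fderiv]
    rfl
  obtain ⟨ε, hε, Φ, hΦ, hΦ0⟩ := exists_smooth_variation_of_linearization
    (F := ⟨g, hg.continuous⟩) hg hab (z := z) (w := w)
    (fun t ht => (hzd t (habI ht)).congr_deriv (hgf (hzN t ht)).symm)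
    (fun t ht => (hasDerivAt_prodMk_deriv hIopen hJsmooth (habI ht)).congr_deriv (by
      rw [hJjac t (habI ht)]
      exact (hfd _ (hzN t ht) (w t)).symm)) hN hzN
  have hΦf : ∀ s ∈ Ioo (-ε) ε, ∀ t ∈ Ioo a b, HasDerivAt (fun t => Φ t s) (f (Φ t s)) t :=
    fun s hs t ht => (hΦ t ht s hs).2.1.congr_deriv (hgf (hΦ t ht s hs).2.2)
  have hd1 : ∀ s ∈ Ioo (-ε) ε, ∀ t ∈ Ioo a b, deriv (fun t => (Φ t s).1) t = (Φ t s).2 :=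
    fun s hs t ht => by
      simpa using (hΦf s hs t ht).hasFDerivAt.fst.hasDerivAt.deriv
  refine ⟨ε, hε, fun t s => (Φ t s).1, fun p hp => ?_, fun s hs => ?_, fun t ht => ?_,
    fun t ht => ?_⟩
  · exact (hΦ p.1 (hsub hp.1) p.2 hp.2).1.fst.contDiffWithinAt
  · refine ⟨Ioo a b, fun t => (Φ t s).1, isOpen_Ioo, ordConnected_Ioo, hsub, fun t ht => ?_,
      fun t ht => ?_, fun t ht => ?_, fun t _ => rfl⟩
    · have hpair : ContDiffAt ℝ (⊤ : ℕ∞) (fun t : ℝ => (t, s)) t :=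
        contDiffAt_id.prodMk contDiffAt_const
      exact (ContDiffAt.comp t (hΦ t ht s hs).1.fst hpair).contDiffWithinAt
    · rw [hd1 s hs t ht]
      exact hNU (hΦ t ht s hs).2.2
    · have hev : deriv (fun t => (Φ t s).1) =ᶠ[nhds t] fun t => (Φ t s).2 := by
        filter_upwards [Ioo_mem_nhds ht.1 ht.2] with r hr using hd1 s hs r hr
      rw [hev.deriv_eq, hd1 s hs t ht]
      exact (hasFDerivAt_snd.comp_hasDerivAt t (hΦf s hs t ht)).deriv.trans (by simp [hf])
  · exact congrArg Prod.fst (hΦ0 t (hsub ht)).1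
  · simpa using (hΦ0 t (hsub ht)).2.hasFDerivAt.fst.hasDerivAt.deriv
end

section
/- If the quadruple of smooth curves (x, y, X, Y) : I → E⁴ solves the S^cc system, then so does the swapped quadruple (x, X, y, Y). (In the paper this is the statement that κ_r ∘ j is a geodesic of S^r when j is; it follows from the symmetry of the second Fréchet derivative D²G.) -/
open Set

/-- If the quadruple of smooth curves `(x, y, X, Y)` solves the `S^cc` system
of the spray with coefficients `G`, then so does the swapped quadruple `(x, X, y, Y)`.
(In the paper: `κ_r ∘ j` is a geodesic of `S^r` when `j` is; this follows from the symmetry of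
the second Fréchet derivative `D²G`.) -/
theorem scc_system_swap_invariant
    {E : Type*} [NormedAddCommGroup E] [NormedSpace ℝ E] [FiniteDimensional ℝ E] [Nontrivial E]
    (G : E × E → E)
    (hGsmooth : ContDiffOn ℝ (⊤ : ℕ∞) G {p : E × E | p.2 ≠ 0})
    (hGhom : ∀ (x y : E) (l : ℝ), 0 < l → y ≠ 0 → G (x, l • y) = l ^ 2 • G (x, y))
    (I : Set ℝ) (hIopen : IsOpen I) (hIconn : I.OrdConnected)
    (x y X Y : ℝ → E)
    (hxsmooth : ContDiffOn ℝ (⊤ : ℕ∞) x I) (hysmooth : ContDiffOn ℝ (⊤ : ℕ∞) y I)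
    (hXsmooth : ContDiffOn ℝ (⊤ : ℕ∞) X I) (hYsmooth : ContDiffOn ℝ (⊤ : ℕ∞) Y I)
    (hxreg : ∀ t ∈ I, deriv x t ≠ 0)
    (hxgeo : ∀ t ∈ I, deriv (deriv x) t = (-2 : ℝ) • G (x t, deriv x t))
    (hyjac : ∀ t ∈ I,
      deriv (deriv y) t = (-2 : ℝ) • fderiv ℝ G (x t, deriv x t) (y t, deriv y t))
    (hXjac : ∀ t ∈ I,
      deriv (deriv X) t = (-2 : ℝ) • fderiv ℝ G (x t, deriv x t) (X t, deriv X t))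
    (hYeq : ∀ t ∈ I,
      deriv (deriv Y) t
        = (-2 : ℝ) • fderiv ℝ G (x t, deriv x t) (Y t, deriv Y t)
          - (2 : ℝ) • fderiv ℝ (fderiv ℝ G) (x t, deriv x t)
              (y t, deriv y t) (X t, deriv X t)) :
    ∀ t ∈ I,
      deriv (deriv x) t = (-2 : ℝ) • G (x t, deriv x t) ∧
      deriv (deriv X) t = (-2 : ℝ) • fderiv ℝ G (x t, deriv x t) (X t, deriv X t) ∧
      deriv (deriv y) t = (-2 : ℝ) • fderiv ℝ G (x t, deriv x t) (y t, deriv y t) ∧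
      deriv (deriv Y) t
        = (-2 : ℝ) • fderiv ℝ G (x t, deriv x t) (Y t, deriv Y t)
          - (2 : ℝ) • fderiv ℝ (fderiv ℝ G) (x t, deriv x t)
              (X t, deriv X t) (y t, deriv y t) := by
  intro t ht
  refine ⟨hxgeo t ht, hXjac t ht, hyjac t ht, ?_⟩
  have hopen : IsOpen {p : E × E | p.2 ≠ 0} := isOpen_ne_fun continuous_snd continuous_const
  have hG : ContDiffAt ℝ (⊤ : ℕ∞) G (x t, deriv x t) :=
    hGsmooth.contDiffAt (hopen.mem_nhds (hxreg t ht))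
  have hsymm : IsSymmSndFDerivAt ℝ G (x t, deriv x t) :=
    hG.isSymmSndFDerivAt (by
      rw [minSmoothness_of_isRCLikeNormedField]
      exact WithTop.coe_le_coe.2 le_top)
  rw [hYeq t ht, hsymm.eq]
end

section
/- Let x : I → E be a geodesic of G on an open interval I containing [0, L] with L > 0, and let J be a Jacobi field along x with J(0) = J(L) = 0 and J not identically zero. Then the quadruple (x, x', 0, J) solves the S^cc system. Consequently the pair (0, J) is a Jacobi field for S^c along the geodesic (x, x') of S^c, vanishing at t = 0 and t = L but not identically; i.e., there are nonzero conjugate points x'(0) ∈ E \ {0} and x'(L) ∈ E \ {0} for the complete lift S^c. -/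
open Set

/-- The velocity field of a solution of `x'' = -2 G(x, x')` solves the linearized equation. -/
theorem deriv_deriv_velocity_of_geodesic
    {E : Type*} [NormedAddCommGroup E] [NormedSpace ℝ E] {G : E × E → E} {x : ℝ → E} {t : ℝ}
    (hG : DifferentiableAt ℝ G (x t, deriv x t))
    (hx : DifferentiableAt ℝ x t) (hx' : DifferentiableAt ℝ (deriv x) t)
    (hgeo : ∀ᶠ s in nhds t, deriv (deriv x) s = (-2 : ℝ) • G (x s, deriv x s)) :
    deriv (deriv (deriv x)) t
      = (-2 : ℝ) • fderiv ℝ G (x t, deriv x t) (deriv x t, deriv (deriv x) t) := by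
  have hgeo' : deriv (deriv x) =ᶠ[nhds t] fun s => (-2 : ℝ) • G (x s, deriv x s) := hgeo
  rw [hgeo'.deriv_eq]
  have hpair : HasDerivAt (fun s => (x s, deriv x s)) (deriv x t, deriv (deriv x) t) t :=
    hx.hasDerivAt.prodMk hx'.hasDerivAt
  exact ((hG.hasFDerivAt.comp_hasDerivAt t hpair).const_smul (-2 : ℝ)).deriv

/-- Let `x` be a geodesic of the spray with coefficients `G` on an open
interval `I ⊇ [0, L]`, `L > 0`, and let `J` be a Jacobi field along `x` with
`J(0) = J(L) = 0` and `J` not identically zero.  Then the quadruple `(x, x', 0, J)` solves the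
`S^cc` system; consequently `(0, J)` is a Jacobi field for `S^c` along the geodesic `(x, x')`
of `S^c`, vanishing at `t = 0` and `t = L` but not identically — there are nonzero conjugate
points `x'(0) ≠ 0` and `x'(L) ≠ 0` for the complete lift `S^c`. -/
theorem nonzero_conjugate_points_for_complete_lift
    {E : Type*} [NormedAddCommGroup E] [NormedSpace ℝ E] [FiniteDimensional ℝ E] [Nontrivial E]
    (G : E × E → E)
    (hGsmooth : ContDiffOn ℝ (⊤ : ℕ∞) G {p : E × E | p.2 ≠ 0})
    (hGhom : ∀ (x y : E) (l : ℝ), 0 < l → y ≠ 0 → G (x, l • y) = l ^ 2 • G (x, y))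
    (I : Set ℝ) (hIopen : IsOpen I) (hIconn : I.OrdConnected)
    (L : ℝ) (hL : 0 < L) (hIcc : Icc 0 L ⊆ I)
    (x : ℝ → E)
    (hxsmooth : ContDiffOn ℝ (⊤ : ℕ∞) x I)
    (hxreg : ∀ t ∈ I, deriv x t ≠ 0)
    (hxgeo : ∀ t ∈ I, deriv (deriv x) t = (-2 : ℝ) • G (x t, deriv x t))
    (J : ℝ → E)
    (hJsmooth : ContDiffOn ℝ (⊤ : ℕ∞) J I)
    (hJjac : ∀ t ∈ I,
      deriv (deriv J) t = (-2 : ℝ) • fderiv ℝ G (x t, deriv x t) (J t, deriv J t))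
    (hJ0 : J 0 = 0) (hJL : J L = 0)
    (hJne : ¬ ∀ t ∈ Icc 0 L, J t = 0) :
    (∀ t ∈ I,
      deriv (deriv x) t = (-2 : ℝ) • G (x t, deriv x t) ∧
      deriv (deriv (deriv x)) t
        = (-2 : ℝ) • fderiv ℝ G (x t, deriv x t) (deriv x t, deriv (deriv x) t) ∧
      deriv (deriv (fun _ : ℝ => (0 : E))) t
        = (-2 : ℝ) • fderiv ℝ G (x t, deriv x t)
            ((0 : E), deriv (fun _ : ℝ => (0 : E)) t) ∧
      deriv (deriv J) t
        = (-2 : ℝ) • fderiv ℝ G (x t, deriv x t) (J t, deriv J t)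
          - (2 : ℝ) • fderiv ℝ (fderiv ℝ G) (x t, deriv x t)
              (deriv x t, deriv (deriv x) t)
              ((0 : E), deriv (fun _ : ℝ => (0 : E)) t)) ∧
    deriv x 0 ≠ 0 ∧ deriv x L ≠ 0 ∧
    (((0 : E), J 0) = (((0 : E), (0 : E)) : E × E)) ∧
    (((0 : E), J L) = (((0 : E), (0 : E)) : E × E)) ∧
    ¬ ∀ t ∈ Icc 0 L, (((0 : E), J t) : E × E) = ((0 : E), (0 : E)) := by
  have h0 : (0 : ℝ) ∈ I := hIcc ⟨le_rfl, hL.le⟩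
  have hLI : L ∈ I := hIcc ⟨hL.le, le_rfl⟩
  have hx'smooth : ContDiffOn ℝ (⊤ : ℕ∞) (deriv x) I :=
    ((contDiffOn_infty_iff_deriv_of_isOpen hIopen).1 hxsmooth).2
  have hopen : IsOpen {p : E × E | p.2 ≠ 0} := isOpen_ne.preimage continuous_snd
  refine ⟨fun t ht => ⟨hxgeo t ht, ?_, by simp [Prod.mk_zero_zero],
      by simpa [Prod.mk_zero_zero] using hJjac t ht⟩,
    hxreg 0 h0, hxreg L hLI, by rw [hJ0], by rw [hJL], ?_⟩
  · have hI := hIopen.mem_nhds ht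
    apply deriv_deriv_velocity_of_geodesic
    · exact (hGsmooth.contDiffAt (hopen.mem_nhds (hxreg t ht))).differentiableAt (by simp)
    · exact (hxsmooth.contDiffAt hI).differentiableAt (by simp)
    · exact (hx'smooth.contDiffAt hI).differentiableAt (by simp)
    · filter_upwards [hI] with s hs using hxgeo s hs
  · exact fun h => hJne fun t ht => congrArg Prod.snd (h t ht)
end

section
/- Let (x, y) : I → E × E solve the first two equations of the S^cc system on an open interval I containing [0, L] (i.e., (x, y) is a geodesic of the complete lift S^c), and let (X, Y) : I → E × E be smooth curves satisfying the last two equations of the S^cc system along (x, y), namely X'' = -2·DG(x, x')·(X, X') and Y'' = -2·DG(x, x')·(Y, Y') - 2·D²G(x, x')·[(y, y'), (X, X')]. Suppose (X(0), Y(0)) = (X(L), Y(L)) = (0, 0) and (X, Y) is not identically zero on [0, L]. Then there exists a Jacobi field K along the geodesic x with K(0) = K(L) = 0 and K not identically zero on [0, L]. (That is, if two points of E × E are conjugate for S^c, then their projections to E are conjugate for S; one may take K = X if X is not identically zero, and K = Y otherwise.) -/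
open Set

/-- A solution of a linear ODE with continuous coefficients on an open interval that vanishes at
one point vanishes on the whole interval. -/
theorem eqOn_zero_of_linear_ODE {F : Type*} [NormedAddCommGroup F] [NormedSpace ℝ F]
    {A : ℝ → F →L[ℝ] F} {I : Set ℝ} (hIopen : IsOpen I) (hIconn : I.OrdConnected)
    (hA : ContinuousOn A I) {f : ℝ → F} (hf : ∀ t ∈ I, HasDerivAt f (A t (f t)) t)
    {t₀ : ℝ} (ht₀ : t₀ ∈ I) (h₀ : f t₀ = 0) : EqOn f 0 I := by
  intro t ht
  obtain ⟨a, ha, hat⟩ : ∃ a ∈ I, a < min t₀ t :=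
    (Filter.Eventually.and (f := nhdsWithin _ (Iio _)) (mem_nhdsWithin_of_mem_nhds
      (hIopen.mem_nhds (min_rec' (· ∈ I) ht₀ ht))) self_mem_nhdsWithin).exists
  obtain ⟨b, hb, hbt⟩ : ∃ b ∈ I, max t₀ t < b :=
    (Filter.Eventually.and (f := nhdsWithin _ (Ioi _)) (mem_nhdsWithin_of_mem_nhds
      (hIopen.mem_nhds (max_rec' (· ∈ I) ht₀ ht))) self_mem_nhdsWithin).exists
  have hsub : Icc a b ⊆ I := hIconn.out ha hb
  obtain ⟨C, hC⟩ := isCompact_Icc.exists_bound_of_continuousOn (hA.mono hsub)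
  refine ODE_solution_unique_of_mem_Ioo (v := fun t p => A t p) (s := fun _ => univ)
    (K := C.toNNReal) (a := a) (b := b) (t₀ := t₀) (g := 0) (fun s hs => ?_)
    ⟨(lt_min_iff.1 hat).1, (max_lt_iff.1 hbt).1⟩
    (fun s hs => ⟨hf s (hsub (Ioo_subset_Icc_self hs)), mem_univ _⟩)
    (fun s _ => ⟨by simp, mem_univ _⟩)
    h₀ ⟨(lt_min_iff.1 hat).2, (max_lt_iff.1 hbt).2⟩
  refine ((A s).lipschitz.weaken ?_).lipschitzOnWith
  exact NNReal.le_toNNReal_of_coe_le (hC s (Ioo_subset_Icc_self hs))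

/-- Let `(x, y)` solve the first two equations of the `S^cc` system on an open
interval `I ⊇ [0, L]` (so `(x, y)` is a geodesic of the complete lift `S^c`), and let `(X, Y)`
be smooth curves satisfying the last two equations of the `S^cc` system along `(x, y)`.  If
`(X, Y)` vanishes at `t = 0` and `t = L` but is not identically zero on `[0, L]`, then there is
a Jacobi field `K` along the geodesic `x` with `K(0) = K(L) = 0` and `K` not identically zero
on `[0, L]`: conjugate points for `S^c` project to conjugate points for `S`. -/
theorem conjugate_points_project
    {E : Type*} [NormedAddCommGroup E] [NormedSpace ℝ E] [FiniteDimensional ℝ E] [Nontrivial E]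
    (G : E × E → E)
    (hGsmooth : ContDiffOn ℝ (⊤ : ℕ∞) G {p : E × E | p.2 ≠ 0})
    (hGhom : ∀ (x y : E) (l : ℝ), 0 < l → y ≠ 0 → G (x, l • y) = l ^ 2 • G (x, y))
    (I : Set ℝ) (hIopen : IsOpen I) (hIconn : I.OrdConnected)
    (L : ℝ) (hL : 0 < L) (hIcc : Icc 0 L ⊆ I)
    (x y X Y : ℝ → E)
    (hxsmooth : ContDiffOn ℝ (⊤ : ℕ∞) x I) (hysmooth : ContDiffOn ℝ (⊤ : ℕ∞) y I)
    (hXsmooth : ContDiffOn ℝ (⊤ : ℕ∞) X I) (hYsmooth : ContDiffOn ℝ (⊤ : ℕ∞) Y I)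
    (hxreg : ∀ t ∈ I, deriv x t ≠ 0)
    (hxgeo : ∀ t ∈ I, deriv (deriv x) t = (-2 : ℝ) • G (x t, deriv x t))
    (hyjac : ∀ t ∈ I,
      deriv (deriv y) t = (-2 : ℝ) • fderiv ℝ G (x t, deriv x t) (y t, deriv y t))
    (hXjac : ∀ t ∈ I,
      deriv (deriv X) t = (-2 : ℝ) • fderiv ℝ G (x t, deriv x t) (X t, deriv X t))
    (hYeq : ∀ t ∈ I,
      deriv (deriv Y) t
        = (-2 : ℝ) • fderiv ℝ G (x t, deriv x t) (Y t, deriv Y t)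
          - (2 : ℝ) • fderiv ℝ (fderiv ℝ G) (x t, deriv x t)
              (y t, deriv y t) (X t, deriv X t))
    (hXY0 : X 0 = 0 ∧ Y 0 = 0) (hXYL : X L = 0 ∧ Y L = 0)
    (hXYne : ¬ ∀ t ∈ Icc 0 L, X t = 0 ∧ Y t = 0) :
    ∃ K : ℝ → E,
      ContDiffOn ℝ (⊤ : ℕ∞) K I ∧
      (∀ t ∈ I,
        deriv (deriv K) t = (-2 : ℝ) • fderiv ℝ G (x t, deriv x t) (K t, deriv K t)) ∧
      K 0 = 0 ∧ K L = 0 ∧ ¬ ∀ t ∈ Icc 0 L, K t = 0 := by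
  have hderiv : ∀ {f : ℝ → E} {s : Set ℝ} {t : ℝ}, IsOpen s → t ∈ s →
      ContDiffOn ℝ (⊤ : ℕ∞) f s → HasDerivAt f (deriv f t) t := fun hs ht hf =>
    ((hf.differentiableOn (by simp)).differentiableAt (hs.mem_nhds ht)).hasDerivAt
  have hderiv_smooth : ∀ {f : ℝ → E}, ContDiffOn ℝ (⊤ : ℕ∞) f I →
      ContDiffOn ℝ (⊤ : ℕ∞) (deriv f) I := fun hf => hf.deriv_of_isOpen hIopen (by simp)
  by_cases hX : ∀ t ∈ Icc 0 L, X t = 0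
  · have hDG : ContinuousOn (fun t => fderiv ℝ G (x t, deriv x t)) I :=
      (hGsmooth.continuousOn_fderiv_of_isOpen (isOpen_ne_fun continuous_snd continuous_const)
        (by simp)).comp (hxsmooth.continuousOn.prodMk (hderiv_smooth hxsmooth).continuousOn) hxreg
    have hmid : L / 2 ∈ Ioo 0 L := ⟨by linarith, by linarith⟩
    have hXlocal : X =ᶠ[nhds (L / 2)] fun _ => 0 :=
      Filter.mem_of_superset (Icc_mem_nhds hmid.1 hmid.2) hX
    have hzero : EqOn (fun t => (X t, deriv X t)) 0 I := by
      refine eqOn_zero_of_linear_ODE hIopen hIconn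
        (A := fun t => (ContinuousLinearMap.snd ℝ E E).prod
          ((-2 : ℝ) • fderiv ℝ G (x t, deriv x t))) ?_ (fun t ht => ?_)
        (hIcc (Ioo_subset_Icc_self hmid)) ?_
      · exact (ContinuousLinearMap.prodₗᵢ ℝ).continuous.comp_continuousOn
          (continuousOn_const.prodMk (hDG.const_smul (-2 : ℝ)))
      · have h := hderiv hIopen ht (hderiv_smooth hXsmooth)
        rw [hXjac t ht] at h
        exact (hderiv hIopen ht hXsmooth).prodMk h
      · simp [hXlocal.eq_of_nhds, hXlocal.deriv_eq]
    refine ⟨Y, hYsmooth, fun t ht => ?_, hXY0.2, hXYL.2,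
      fun hY => hXYne fun t ht => ⟨hX t ht, hY t ht⟩⟩
    have hXt : (X t, deriv X t) = 0 := hzero ht
    rw [hYeq t ht, hXt, map_zero, smul_zero, sub_zero]
  · exact ⟨X, hXsmooth, hXjac, hXY0.1, hXYL.1, hX⟩
end

section
/- For every geodesic x : I → E of G and all α, β ∈ ℝ, the parallel-form quadruple γ(t) = (x(t), x'(t), (α + β·t)·x'(t), (α + β·t)·x''(t) + β·x'(t)) solves the S^cc system on I. (Equivalently: for every parallel Jacobi field J(t) = (α + β·t)·x'(t), the coordinate curve corresponding to κ₂ ∘ J' is a geodesic of S^cc; this is the forward direction of the paper's characterization of geodesics in the sub-spray P.) -/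
open Set Filter Topology

/-- Euler's identity for a function that is positively 2-homogeneous in its second variable. -/
lemma fderiv_apply_zero_snd_of_homogeneous
    {E F : Type*} [NormedAddCommGroup E] [NormedSpace ℝ E]
    [NormedAddCommGroup F] [NormedSpace ℝ F] {G : E × E → F} {p : E × E}
    (hG : DifferentiableAt ℝ G p)
    (hhom : ∀ l : ℝ, 0 < l → G (p.1, l • p.2) = l ^ 2 • G p) :
    fderiv ℝ G p (0, p.2) = (2 : ℝ) • G p := by
  have hray : HasDerivAt (fun l : ℝ => (p.1, l • p.2)) (0, p.2) 1 := by
    simpa using (hasDerivAt_const (1 : ℝ) p.1).prodMk ((hasDerivAt_id (1 : ℝ)).smul_const p.2)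
  have hcomp : HasDerivAt (fun l : ℝ => G (p.1, l • p.2)) (fderiv ℝ G p (0, p.2)) 1 :=
    HasFDerivAt.comp_hasDerivAt (l := G) 1 (by simpa using hG.hasFDerivAt) hray
  have hsq : HasDerivAt (fun l : ℝ => l ^ 2 • G p) ((2 : ℝ) • G p) 1 := by
    simpa using (hasDerivAt_pow 2 (1 : ℝ)).smul_const (G p)
  refine hcomp.unique (hsq.congr_of_eventuallyEq ?_)
  filter_upwards [lt_mem_nhds (zero_lt_one' ℝ)] with l hl using hhom l hl

/-- For every geodesic `x : I → E` of the spray with coefficients `G` and all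
`α, β ∈ ℝ`, the parallel-form quadruple
`γ(t) = (x(t), x'(t), (α + β·t)·x'(t), (α + β·t)·x''(t) + β·x'(t))`
solves the `S^cc` system on `I`.  (Equivalently: for every parallel Jacobi field
`J(t) = (α + β·t)·x'(t)`, the coordinate curve corresponding to `κ₂ ∘ J'` is a geodesic of
`S^cc` — the forward direction of the characterization of geodesics of the sub-spray `P`.) -/
theorem parallel_form_quadruple_solves_scc
    {E : Type*} [NormedAddCommGroup E] [NormedSpace ℝ E] [FiniteDimensional ℝ E] [Nontrivial E]
    (G : E × E → E)
    (hGsmooth : ContDiffOn ℝ (⊤ : ℕ∞) G {p : E × E | p.2 ≠ 0})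
    (hGhom : ∀ (x y : E) (l : ℝ), 0 < l → y ≠ 0 → G (x, l • y) = l ^ 2 • G (x, y))
    (I : Set ℝ) (hIopen : IsOpen I) (hIconn : I.OrdConnected)
    (x : ℝ → E)
    (hxsmooth : ContDiffOn ℝ (⊤ : ℕ∞) x I)
    (hxreg : ∀ t ∈ I, deriv x t ≠ 0)
    (hxgeo : ∀ t ∈ I, deriv (deriv x) t = (-2 : ℝ) • G (x t, deriv x t))
    (α β : ℝ) :
    ∀ t ∈ I,
      deriv (deriv x) t = (-2 : ℝ) • G (x t, deriv x t) ∧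
      deriv (deriv (deriv x)) t
        = (-2 : ℝ) • fderiv ℝ G (x t, deriv x t) (deriv x t, deriv (deriv x) t) ∧
      deriv (deriv (fun u => (α + β * u) • deriv x u)) t
        = (-2 : ℝ) • fderiv ℝ G (x t, deriv x t)
            ((α + β * t) • deriv x t, deriv (fun u => (α + β * u) • deriv x u) t) ∧
      deriv (deriv (fun u => (α + β * u) • deriv (deriv x) u + β • deriv x u)) t
        = (-2 : ℝ) • fderiv ℝ G (x t, deriv x t)
            ((α + β * t) • deriv (deriv x) t + β • deriv x t,
              deriv (fun u => (α + β * u) • deriv (deriv x) u + β • deriv x u) t)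
          - (2 : ℝ) • fderiv ℝ (fderiv ℝ G) (x t, deriv x t)
              (deriv x t, deriv (deriv x) t)
              ((α + β * t) • deriv x t, deriv (fun u => (α + β * u) • deriv x u) t) := by
  have hUopen : IsOpen {p : E × E | p.2 ≠ 0} := isOpen_ne_fun continuous_snd continuous_const
  have hG : ∀ t ∈ I, ContDiffAt ℝ (⊤ : ℕ∞) G (x t, deriv x t) := fun t ht =>
    hGsmooth.contDiffAt (hUopen.mem_nhds (hxreg t ht))
  have hGdiff : ∀ t ∈ I, HasFDerivAt G (fderiv ℝ G (x t, deriv x t)) (x t, deriv x t) :=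
    fun t ht => ((hG t ht).differentiableAt (by simp)).hasFDerivAt
  have hDGdiff : ∀ t ∈ I, HasFDerivAt (fderiv ℝ G)
      (fderiv ℝ (fderiv ℝ G) (x t, deriv x t)) (x t, deriv x t) := fun t ht =>
    (((hG t ht).fderiv_right (m := 1) (by norm_cast)).differentiableAt
      (by simp)).hasFDerivAt
  have hvsmooth : ContDiffOn ℝ (⊤ : ℕ∞) (deriv x) I :=
    hxsmooth.deriv_of_isOpen hIopen (by norm_cast)
  have hx : ∀ t ∈ I, HasDerivAt x (deriv x t) t := fun t ht =>
    ((hxsmooth.contDiffAt (hIopen.mem_nhds ht)).differentiableAt (by simp)).hasDerivAt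
  have hv : ∀ t ∈ I, HasDerivAt (deriv x) (deriv (deriv x) t) t := fun t ht =>
    ((hvsmooth.contDiffAt (hIopen.mem_nhds ht)).differentiableAt (by simp)).hasDerivAt
  have hxv : ∀ t ∈ I, HasDerivAt (fun u => (x u, deriv x u)) (deriv x t, deriv (deriv x) t) t :=
    fun t ht => (hx t ht).prodMk (hv t ht)
  have ha : ∀ t ∈ I, HasDerivAt (deriv (deriv x))
      ((-2 : ℝ) • fderiv ℝ G (x t, deriv x t) (deriv x t, deriv (deriv x) t)) t := fun t ht =>
    (((hGdiff t ht).comp_hasDerivAt t (hxv t ht)).const_smul (-2 : ℝ)).congr_of_eventuallyEq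
      (eventually_of_mem (hIopen.mem_nhds ht) hxgeo)
  have hf : ∀ t : ℝ, HasDerivAt (fun u => α + β * u) β t := fun t => by
    simpa using ((hasDerivAt_id t).const_mul β).const_add α
  set J : ℝ → E := fun u => (α + β * u) • deriv x u with hJdef
  set Y : ℝ → E := fun u => (α + β * u) • deriv (deriv x) u + β • deriv x u with hYdef
  have hJ : ∀ t ∈ I, HasDerivAt J (Y t) t := fun t ht => (hf t).smul (hv t ht)
  have hY : ∀ t ∈ I, HasDerivAt Y ((-2 : ℝ) • fderiv ℝ G (x t, deriv x t) (J t, Y t)) t := by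
    intro t ht
    refine (((hf t).smul (ha t ht)).add ((hv t ht).const_smul β)).congr_deriv ?_
    have heuler : fderiv ℝ G (x t, deriv x t) (0, deriv x t) = (2 : ℝ) • G (x t, deriv x t) :=
      fderiv_apply_zero_snd_of_homogeneous (hGdiff t ht).differentiableAt
        fun l hl => hGhom _ _ l hl (hxreg t ht)
    have hsplit : (J t, Y t) = (α + β * t) • (deriv x t, deriv (deriv x) t)
        + β • ((0 : E), deriv x t) := by simp [hJdef, hYdef]
    rw [hsplit, map_add, map_smul, map_smul, heuler, hxgeo t ht]
    module
  have hJ' : ∀ t ∈ I, deriv J =ᶠ[𝓝 t] Y := fun t ht =>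
    eventually_of_mem (hIopen.mem_nhds ht) fun u hu => (hJ u hu).deriv
  have hY' : ∀ t ∈ I, deriv Y =ᶠ[𝓝 t]
      fun u => (-2 : ℝ) • fderiv ℝ G (x u, deriv x u) (J u, Y u) := fun t ht =>
    eventually_of_mem (hIopen.mem_nhds ht) fun u hu => (hY u hu).deriv
  intro t ht
  refine ⟨hxgeo t ht, (ha t ht).deriv, ?_, ?_⟩
  · rw [(hJ' t ht).deriv_eq, (hJ t ht).deriv]
    exact (hY t ht).deriv
  · have hDG : HasDerivAt (fun u => fderiv ℝ G (x u, deriv x u))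
        (fderiv ℝ (fderiv ℝ G) (x t, deriv x t) (deriv x t, deriv (deriv x) t)) t :=
      (hDGdiff t ht).comp_hasDerivAt t (hxv t ht)
    have hJY : HasDerivAt (fun u => (J u, Y u)) (Y t, deriv Y t) t :=
      (hJ t ht).prodMk (hY t ht).differentiableAt.hasDerivAt
    rw [(hY' t ht).deriv_eq, (hJ t ht).deriv]
    refine ((hDG.clm_apply hJY).const_smul (-2 : ℝ)).deriv.trans ?_
    simp only [hJdef, hYdef]
    module
end

section
/- Suppose G is smooth on E × (E \ {0}). Let (x, y, X, Y) : I → E⁴ solve the S^cc system on an open interval I containing 0, and suppose there exist α, β ∈ ℝ such that the initial data has parallel form: y(0) = x'(0), y'(0) = x''(0), X(0) = α·x'(0), X'(0) = α·x''(0) + β·x'(0), Y(0) = α·x''(0) + β·x'(0), and Y'(0) = α·x'''(0) + 2β·x''(0) (here x is smooth since G is smooth, so x'''(0) exists). Then for all t ∈ I: y(t) = x'(t), X(t) = (α + β·t)·x'(t), and Y(t) = (α + β·t)·x''(t) + β·x'(t). (This is the coordinate form of the statement that the semi-distribution Δ defining the sub-spray P is geodesically invariant for S^cc.) -/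
open Set

/-- Two solutions of the second order linear equation `f'' = A(t) (f, f') + b(t)` on an open
interval agree if they have the same initial position and velocity. -/
theorem eqOn_of_second_order_linear {E : Type*} [NormedAddCommGroup E] [NormedSpace ℝ E]
    {I : Set ℝ} (hIopen : IsOpen I) (hIconn : I.OrdConnected) {t₀ : ℝ} (ht₀ : t₀ ∈ I)
    {A : ℝ → E × E →L[ℝ] E} (hA : ContinuousOn A I) {b f f' g g' : ℝ → E}
    (hf : ∀ t ∈ I, HasDerivAt f (f' t) t)
    (hf' : ∀ t ∈ I, HasDerivAt f' (A t (f t, f' t) + b t) t)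
    (hg : ∀ t ∈ I, HasDerivAt g (g' t) t)
    (hg' : ∀ t ∈ I, HasDerivAt g' (A t (g t, g' t) + b t) t)
    (h₀ : f t₀ = g t₀) (h₀' : f' t₀ = g' t₀) :
    EqOn (fun t ↦ (f t, f' t)) (fun t ↦ (g t, g' t)) I := by
  intro t ht
  have hmin : min t₀ t ∈ I := by rcases min_choice t₀ t with h | h <;> rwa [h]
  have hmax : max t₀ t ∈ I := by rcases max_choice t₀ t with h | h <;> rwa [h]
  obtain ⟨p, hp, hpI⟩ := (exists_Ioc_subset_of_mem_nhds (hIopen.mem_nhds hmin) (exists_lt _))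
  obtain ⟨q, hq, hqI⟩ := (exists_Ico_subset_of_mem_nhds (hIopen.mem_nhds hmax) (exists_gt _))
  obtain ⟨p', hpp', hp'⟩ := exists_between hp
  obtain ⟨q', hq', hqq'⟩ := exists_between hq
  have hsub : Icc p' q' ⊆ I :=
    hIconn.out (hpI ⟨hpp', hp'.le⟩) (hqI ⟨hq'.le, hqq'⟩)
  obtain ⟨C, hC⟩ := isCompact_Icc.exists_bound_of_continuousOn (hA.mono hsub)
  have hsub' : Ioo p' q' ⊆ I := Ioo_subset_Icc_self.trans hsub
  refine ODE_solution_unique_of_mem_Ioo (a := p') (b := q') (t₀ := t₀) (s := fun _ ↦ univ)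
    (v := fun t z ↦ (z.2, A t z + b t)) (K := max 1 C.toNNReal) ?_
    ⟨hp'.trans_le (min_le_left _ _), (le_max_left _ _).trans_lt hq'⟩
    (fun s hs ↦ ⟨(hf s (hsub' hs)).prodMk (hf' s (hsub' hs)), mem_univ _⟩)
    (fun s hs ↦ ⟨(hg s (hsub' hs)).prodMk (hg' s (hsub' hs)), mem_univ _⟩)
    (by simp [h₀, h₀'])
    ⟨hp'.trans_le (min_le_right _ _), (le_max_right _ _).trans_lt hq'⟩
  intro s hs
  have hAs : LipschitzWith C.toNNReal (fun z ↦ A s z + b s) := by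
    refine LipschitzWith.of_dist_le_mul fun z w ↦ ?_
    rw [dist_add_right]
    refine ((A s).lipschitz.dist_le_mul z w).trans ?_
    gcongr
    rw [← NNReal.coe_le_coe, coe_nnnorm]
    exact (hC s (Ioo_subset_Icc_self hs)).trans (Real.le_coe_toNNReal C)
  exact (LipschitzWith.prod_snd.prodMk hAs).lipschitzOnWith

/-- **Euler's relation** in the second variable: `∂₂G(x, y) y = 2 G(x, y)` if `G` is positively
2-homogeneous in the second variable. -/
theorem fderiv_apply_zero_self_of_homogeneous {E F : Type*} [NormedAddCommGroup E]
    [NormedSpace ℝ E] [NormedAddCommGroup F] [NormedSpace ℝ F] {G : E × E → F} {x y : E}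
    (hG : DifferentiableAt ℝ G (x, y))
    (hhom : ∀ l : ℝ, 0 < l → G (x, l • y) = l ^ 2 • G (x, y)) :
    fderiv ℝ G (x, y) (0, y) = (2 : ℝ) • G (x, y) := by
  have hline : HasDerivAt (fun l : ℝ ↦ (x, l • y)) (0, y) 1 := by
    simpa using (hasDerivAt_const (1 : ℝ) x).prodMk ((hasDerivAt_id (1 : ℝ)).smul_const y)
  have hcomp : HasDerivAt (fun l : ℝ ↦ G (x, l • y)) (fderiv ℝ G (x, y) (0, y)) 1 := by
    refine HasFDerivAt.comp_hasDerivAt (1 : ℝ) ?_ hline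
    simpa using hG.hasFDerivAt
  have hpow : HasDerivAt (fun l : ℝ ↦ l ^ 2 • G (x, y)) ((2 : ℝ) • G (x, y)) 1 := by
    simpa using (hasDerivAt_pow 2 (1 : ℝ)).smul_const (G (x, y))
  refine hcomp.unique (hpow.congr_of_eventuallyEq ?_)
  filter_upwards [lt_mem_nhds zero_lt_one] with l hl using hhom l hl

/-- (Geodesic invariance of the semi-distribution `Δ` defining the sub-spray
`P`.)  Suppose `G` is smooth on `E × (E \ {0})`.  Let `(x, y, X, Y)` solve the `S^cc` system
on an open interval `I ∋ 0`, and suppose the initial data has parallel form for some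
`α, β ∈ ℝ`: `y(0) = x'(0)`, `y'(0) = x''(0)`, `X(0) = α·x'(0)`,
`X'(0) = α·x''(0) + β·x'(0)`, `Y(0) = α·x''(0) + β·x'(0)`, `Y'(0) = α·x'''(0) + 2β·x''(0)`.
Then for all `t ∈ I`: `y(t) = x'(t)`, `X(t) = (α + β·t)·x'(t)`, and
`Y(t) = (α + β·t)·x''(t) + β·x'(t)`. -/
theorem semidistribution_geodesically_invariant
    {E : Type*} [NormedAddCommGroup E] [NormedSpace ℝ E] [FiniteDimensional ℝ E] [Nontrivial E]
    (G : E × E → E)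
    (hGsmooth : ContDiffOn ℝ (⊤ : ℕ∞) G {p : E × E | p.2 ≠ 0})
    (hGhom : ∀ (x y : E) (l : ℝ), 0 < l → y ≠ 0 → G (x, l • y) = l ^ 2 • G (x, y))
    (I : Set ℝ) (hIopen : IsOpen I) (hIconn : I.OrdConnected) (h0I : (0 : ℝ) ∈ I)
    (x y X Y : ℝ → E)
    (hxsmooth : ContDiffOn ℝ (⊤ : ℕ∞) x I) (hysmooth : ContDiffOn ℝ (⊤ : ℕ∞) y I)
    (hXsmooth : ContDiffOn ℝ (⊤ : ℕ∞) X I) (hYsmooth : ContDiffOn ℝ (⊤ : ℕ∞) Y I)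
    (hxreg : ∀ t ∈ I, deriv x t ≠ 0)
    (hxgeo : ∀ t ∈ I, deriv (deriv x) t = (-2 : ℝ) • G (x t, deriv x t))
    (hyjac : ∀ t ∈ I,
      deriv (deriv y) t = (-2 : ℝ) • fderiv ℝ G (x t, deriv x t) (y t, deriv y t))
    (hXjac : ∀ t ∈ I,
      deriv (deriv X) t = (-2 : ℝ) • fderiv ℝ G (x t, deriv x t) (X t, deriv X t))
    (hYeq : ∀ t ∈ I,
      deriv (deriv Y) t
        = (-2 : ℝ) • fderiv ℝ G (x t, deriv x t) (Y t, deriv Y t)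
          - (2 : ℝ) • fderiv ℝ (fderiv ℝ G) (x t, deriv x t)
              (y t, deriv y t) (X t, deriv X t))
    (α β : ℝ)
    (hy0 : y 0 = deriv x 0)
    (hy'0 : deriv y 0 = deriv (deriv x) 0)
    (hX0 : X 0 = α • deriv x 0)
    (hX'0 : deriv X 0 = α • deriv (deriv x) 0 + β • deriv x 0)
    (hY0 : Y 0 = α • deriv (deriv x) 0 + β • deriv x 0)
    (hY'0 : deriv Y 0 = α • deriv (deriv (deriv x)) 0 + (2 * β) • deriv (deriv x) 0) :
    ∀ t ∈ I,
      y t = deriv x t ∧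
      X t = (α + β * t) • deriv x t ∧
      Y t = (α + β * t) • deriv (deriv x) t + β • deriv x t := by
  have hasDeriv : ∀ {f : ℝ → E}, ContDiffOn ℝ (⊤ : ℕ∞) f I →
      ∀ t ∈ I, HasDerivAt f (deriv f t) t := fun hf t ht ↦
    ((hf.contDiffAt (hIopen.mem_nhds ht)).differentiableAt (by simp)).hasDerivAt
  have smooth_deriv : ∀ {f : ℝ → E}, ContDiffOn ℝ (⊤ : ℕ∞) f I →
      ContDiffOn ℝ (⊤ : ℕ∞) (deriv f) I := fun hf ↦
    ((contDiffOn_infty_iff_deriv_of_isOpen hIopen).1 hf).2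
  have hslit : IsOpen {p : E × E | p.2 ≠ 0} := isOpen_ne_fun continuous_snd continuous_const
  have hDGsmooth : ContDiffOn ℝ (⊤ : ℕ∞) (fderiv ℝ G) {p : E × E | p.2 ≠ 0} :=
    ((contDiffOn_infty_iff_fderiv_of_isOpen hslit).1 hGsmooth).2
  have hGdiff : ∀ t ∈ I, DifferentiableAt ℝ G (x t, deriv x t) := fun t ht ↦
    (hGsmooth.contDiffAt (hslit.mem_nhds (hxreg t ht))).differentiableAt (by simp)
  have hDGdiff : ∀ t ∈ I, DifferentiableAt ℝ (fderiv ℝ G) (x t, deriv x t) := fun t ht ↦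
    (hDGsmooth.contDiffAt (hslit.mem_nhds (hxreg t ht))).differentiableAt (by simp)
  have hx₁ := hasDeriv hxsmooth
  have hx₂ := hasDeriv (smooth_deriv hxsmooth)
  have hx₃ := hasDeriv (smooth_deriv (smooth_deriv hxsmooth))
  have hA : ContinuousOn (fun t ↦ (-2 : ℝ) • fderiv ℝ G (x t, deriv x t)) I := fun t ht ↦
    (((hDGdiff t ht).continuousAt.comp_of_eq
      ((hx₁ t ht).continuousAt.prodMk (hx₂ t ht).continuousAt) rfl).const_smul
        (-2 : ℝ)).continuousWithinAt
  -- The velocity is a Jacobi field.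
  have hjac : ∀ t ∈ I, deriv (deriv (deriv x)) t =
      (-2 : ℝ) • fderiv ℝ G (x t, deriv x t) (deriv x t, deriv (deriv x) t) := fun t ht ↦ by
    have h := ((hGdiff t ht).hasFDerivAt.comp_hasDerivAt t
      ((hx₁ t ht).prodMk (hx₂ t ht))).const_smul (-2 : ℝ)
    refine (hx₃ t ht).unique (h.congr_of_eventuallyEq ?_)
    filter_upwards [hIopen.mem_nhds ht] with s hs using hxgeo s hs
  have hEuler : ∀ t ∈ I,
      (-2 : ℝ) • fderiv ℝ G (x t, deriv x t) (0, deriv x t) = (2 : ℝ) • deriv (deriv x) t :=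
    fun t ht ↦ by
      rw [fderiv_apply_zero_self_of_homogeneous (hGdiff t ht)
        (fun l hl ↦ hGhom _ _ l hl (hxreg t ht)), hxgeo t ht, smul_comm]
  -- The parallel field `W = (α + β t) x'`, with derivatives `W₁` and `W₂`.
  set W : ℝ → E := fun t ↦ (α + β * t) • deriv x t with hW_def
  set W₁ : ℝ → E := fun t ↦ (α + β * t) • deriv (deriv x) t + β • deriv x t with hW₁_def
  set W₂ : ℝ → E := fun t ↦
    (α + β * t) • deriv (deriv (deriv x)) t + (2 * β) • deriv (deriv x) t with hW₂_def
  have hc : ∀ t : ℝ, HasDerivAt (fun t ↦ α + β * t) β t := fun t ↦ by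
    simpa using ((hasDerivAt_id t).const_mul β).const_add α
  have hW : ∀ t ∈ I, HasDerivAt W (W₁ t) t := fun t ht ↦ (hc t).smul (hx₂ t ht)
  have hW₁ : ∀ t ∈ I, HasDerivAt W₁ (W₂ t) t := fun t ht ↦ by
    refine (((hc t).smul (hx₃ t ht)).add ((hx₂ t ht).const_smul β)).congr_deriv ?_
    simp only [hW₂_def]
    module
  have hWjac : ∀ t ∈ I, W₂ t = (-2 : ℝ) • fderiv ℝ G (x t, deriv x t) (W t, W₁ t) :=
    fun t ht ↦ by
      have hsplit : (W t, W₁ t) = (α + β * t) • (deriv x t, deriv (deriv x) t) +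
          β • ((0 : E), deriv x t) := by simp [hW_def, hW₁_def]
      rw [hsplit, map_add, map_smul, map_smul, smul_add, smul_comm (-2 : ℝ), ← hjac t ht,
        smul_comm (-2 : ℝ), hEuler t ht]
      simp only [hW₂_def]
      module
  have hW₂ : ∀ t ∈ I, HasDerivAt W₂
      ((-2 : ℝ) • fderiv ℝ G (x t, deriv x t) (W₁ t, W₂ t) -
        (2 : ℝ) • fderiv ℝ (fderiv ℝ G) (x t, deriv x t)
          (deriv x t, deriv (deriv x) t) (W t, W₁ t)) t := fun t ht ↦ by
    have hDG : HasDerivAt (fun s ↦ fderiv ℝ G (x s, deriv x s))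
        (fderiv ℝ (fderiv ℝ G) (x t, deriv x t) (deriv x t, deriv (deriv x) t)) t :=
      (hDGdiff t ht).hasFDerivAt.comp_hasDerivAt t ((hx₁ t ht).prodMk (hx₂ t ht))
    have hWW : HasDerivAt (fun s ↦ (W s, W₁ s)) (W₁ t, W₂ t) t := (hW t ht).prodMk (hW₁ t ht)
    refine (((hDG.clm_apply hWW).const_smul (-2 : ℝ)).congr_of_eventuallyEq ?_).congr_deriv ?_
    · filter_upwards [hIopen.mem_nhds ht] with s hs using hWjac s hs
    · rw [smul_add, add_comm, neg_smul 2 (fderiv ℝ (fderiv ℝ G) _ _ _), sub_eq_add_neg]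
  have hjacDeriv : ∀ {t : ℝ} {f : ℝ → E} {d : E} {z : E × E},
      d = (-2 : ℝ) • fderiv ℝ G (x t, deriv x t) z → HasDerivAt f d t →
      HasDerivAt f (((-2 : ℝ) • fderiv ℝ G (x t, deriv x t)) z + 0) t := fun hd hf ↦ by
    rwa [add_zero, smul_apply, ← hd]
  have hW0 : X 0 = W 0 := by simpa [hW_def] using hX0
  have hW₁0 : deriv X 0 = W₁ 0 := by simpa [hW₁_def] using hX'0
  have hW₁0' : Y 0 = W₁ 0 := by simpa [hW₁_def] using hY0
  have hW₂0 : deriv Y 0 = W₂ 0 := by simpa [hW₂_def] using hY'0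
  have hy : EqOn (fun t ↦ (y t, deriv y t)) (fun t ↦ (deriv x t, deriv (deriv x) t)) I :=
    eqOn_of_second_order_linear hIopen hIconn h0I hA (b := fun _ ↦ 0) (hasDeriv hysmooth)
      (fun t ht ↦ hjacDeriv (hyjac t ht) (hasDeriv (smooth_deriv hysmooth) t ht)) hx₂
      (fun t ht ↦ hjacDeriv (hjac t ht) (hx₃ t ht)) hy0 hy'0
  have hX : EqOn (fun t ↦ (X t, deriv X t)) (fun t ↦ (W t, W₁ t)) I :=
    eqOn_of_second_order_linear hIopen hIconn h0I hA (b := fun _ ↦ 0) (hasDeriv hXsmooth)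
      (fun t ht ↦ hjacDeriv (hXjac t ht) (hasDeriv (smooth_deriv hXsmooth) t ht)) hW
      (fun t ht ↦ hjacDeriv (hWjac t ht) (hW₁ t ht)) hW0 hW₁0
  have hY : EqOn (fun t ↦ (Y t, deriv Y t)) (fun t ↦ (W₁ t, W₂ t)) I := by
    refine eqOn_of_second_order_linear hIopen hIconn h0I hA
      (b := fun t ↦ -((2 : ℝ) • fderiv ℝ (fderiv ℝ G) (x t, deriv x t)
        (deriv x t, deriv (deriv x) t) (W t, W₁ t))) (hasDeriv hYsmooth)
      (fun t ht ↦ ?_) hW₁ (fun t ht ↦ ?_) hW₁0' hW₂0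
    · have h := hasDeriv (smooth_deriv hYsmooth) t ht
      have hyt : (y t, deriv y t) = _ := hy ht
      have hXt : (X t, deriv X t) = _ := hX ht
      rw [hYeq t ht, hyt, hXt] at h
      rw [← sub_eq_add_neg]
      exact h
    · rw [← sub_eq_add_neg]
      exact hW₂ t ht
  exact fun t ht ↦
    ⟨congrArg Prod.fst (hy ht), congrArg Prod.fst (hX ht), congrArg Prod.fst (hY ht)⟩
end

section
/- Suppose G is smooth on E × (E \ {0}). For i = 1, 2 let xᵢ : Iᵢ → E be geodesics of G on open intervals containing 0, let αᵢ, βᵢ ∈ ℝ, and let γᵢ(t) = (xᵢ(t), xᵢ'(t), (αᵢ + βᵢ·t)·xᵢ'(t), (αᵢ + βᵢ·t)·xᵢ''(t) + βᵢ·xᵢ'(t)) be the associated parallel-form quadruples. If γ₁(0) = γ₂(0), then α₁ = α₂, β₁ = β₂, and x₁(t) = x₂(t) for all t ∈ I₁ ∩ I₂; hence γ₁ = γ₂ on I₁ ∩ I₂. (A geodesic of the sub-spray P is uniquely determined by its value at a single point; by smoothness of G, geodesics of G with the same initial position and velocity coincide on their common domain.) -/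
open Set

open scoped Topology

/-- Two integral curves of a vector field that is `C¹` on an open set agree on a preconnected open
set of times on which both stay in that open set, as soon as they agree at one time. -/
theorem eqOn_of_hasDerivAt_of_contDiffOn {F : Type*} [NormedAddCommGroup F] [NormedSpace ℝ F]
    {V : F → F} {U : Set F} (hU : IsOpen U) (hV : ContDiffOn ℝ 1 V U)
    {J : Set ℝ} (hJ : IsOpen J) (hJc : IsPreconnected J) {f g : ℝ → F} {t₀ : ℝ} (ht₀ : t₀ ∈ J)
    (hf : ∀ t ∈ J, HasDerivAt f (V (f t)) t) (hfU : ∀ t ∈ J, f t ∈ U)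
    (hg : ∀ t ∈ J, HasDerivAt g (V (g t)) t) (heq : f t₀ = g t₀) :
    EqOn f g J := by
  have key : ∀ t ∈ J, f t = g t → f =ᶠ[𝓝 t] g := by
    intro t ht h
    obtain ⟨K, s, hs, hK⟩ := (hV.contDiffAt (hU.mem_nhds (hfU t ht))).exists_lipschitzOnWith
    have hJt := hJ.mem_nhds ht
    refine ODE_solution_unique_of_eventually (v := fun _ => V) (s := fun _ => s)
      (Filter.Eventually.of_forall fun _ => hK) ?_ ?_ h
    · filter_upwards [hJt, (hf t ht).continuousAt.preimage_mem_nhds hs] with r hr hrs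
      exact ⟨hf r hr, hrs⟩
    · filter_upwards [hJt, (hg t ht).continuousAt.preimage_mem_nhds (h ▸ hs)] with r hr hrs
      exact ⟨hg r hr, hrs⟩
  have hsub : J ⊆ {t | f =ᶠ[𝓝 t] g} := by
    refine hJc.subset_of_closure_inter_subset isOpen_setOfPred_eventually_nhds
      ⟨t₀, ht₀, key t₀ ht₀ heq⟩ ?_
    rintro t ⟨htc, ht⟩
    refine key t ht ?_
    exact tendsto_nhds_unique_of_frequently_eq (hf t ht).continuousAt (hg t ht).continuousAt
      ((mem_closure_iff_frequently.mp htc).mono fun _ hr => hr.self_of_nhds)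
  exact fun t ht => (hsub ht).self_of_nhds

/-- The velocity lift of a geodesic is an integral curve of the spray. -/
theorem hasDerivAt_prodMk_deriv_of_geodesic {E : Type*} [NormedAddCommGroup E] [NormedSpace ℝ E]
    {G : E × E → E} {I : Set ℝ} (hI : IsOpen I) {x : ℝ → E} (hx : ContDiffOn ℝ 2 x I)
    (hgeo : ∀ t ∈ I, deriv (deriv x) t = (-2 : ℝ) • G (x t, deriv x t)) {t : ℝ} (ht : t ∈ I) :
    HasDerivAt (fun r => (x r, deriv x r)) (deriv x t, (-2 : ℝ) • G (x t, deriv x t)) t := by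
  have hx' : ContDiffOn ℝ 1 (deriv x) I := hx.deriv_of_isOpen hI (by norm_num)
  have h₁ := ((hx.contDiffAt (hI.mem_nhds ht)).differentiableAt (by norm_num)).hasDerivAt
  have h₂ := ((hx'.contDiffAt (hI.mem_nhds ht)).differentiableAt (by norm_num)).hasDerivAt
  rw [hgeo t ht] at h₂
  exact h₁.prodMk h₂

/-- Suppose `G` is smooth on `E × (E \ {0})`.  If two parallel-form quadruples
`γᵢ(t) = (xᵢ(t), xᵢ'(t), (αᵢ + βᵢ·t)·xᵢ'(t), (αᵢ + βᵢ·t)·xᵢ''(t) + βᵢ·xᵢ'(t))`, over geodesics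
`xᵢ : Iᵢ → E` of `G` with `0 ∈ Iᵢ`, agree at `t = 0`, then `α₁ = α₂`, `β₁ = β₂`, and
`x₁ = x₂` on `I₁ ∩ I₂`; hence `γ₁ = γ₂` on `I₁ ∩ I₂`.  (A geodesic of the sub-spray `P` is
uniquely determined by its value at a single point.) -/
theorem subspray_geodesic_determined_by_point
    {E : Type*} [NormedAddCommGroup E] [NormedSpace ℝ E] [FiniteDimensional ℝ E] [Nontrivial E]
    (G : E × E → E)
    (hGsmooth : ContDiffOn ℝ (⊤ : ℕ∞) G {p : E × E | p.2 ≠ 0})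
    (hGhom : ∀ (x y : E) (l : ℝ), 0 < l → y ≠ 0 → G (x, l • y) = l ^ 2 • G (x, y))
    (I₁ I₂ : Set ℝ)
    (hI₁open : IsOpen I₁) (hI₁conn : I₁.OrdConnected) (h0I₁ : (0 : ℝ) ∈ I₁)
    (hI₂open : IsOpen I₂) (hI₂conn : I₂.OrdConnected) (h0I₂ : (0 : ℝ) ∈ I₂)
    (x₁ x₂ : ℝ → E) (α₁ β₁ α₂ β₂ : ℝ)
    (hx₁smooth : ContDiffOn ℝ (⊤ : ℕ∞) x₁ I₁) (hx₂smooth : ContDiffOn ℝ (⊤ : ℕ∞) x₂ I₂)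
    (hx₁reg : ∀ t ∈ I₁, deriv x₁ t ≠ 0) (hx₂reg : ∀ t ∈ I₂, deriv x₂ t ≠ 0)
    (hx₁geo : ∀ t ∈ I₁, deriv (deriv x₁) t = (-2 : ℝ) • G (x₁ t, deriv x₁ t))
    (hx₂geo : ∀ t ∈ I₂, deriv (deriv x₂) t = (-2 : ℝ) • G (x₂ t, deriv x₂ t))
    (h0 : x₁ 0 = x₂ 0 ∧
      deriv x₁ 0 = deriv x₂ 0 ∧
      α₁ • deriv x₁ 0 = α₂ • deriv x₂ 0 ∧
      α₁ • deriv (deriv x₁) 0 + β₁ • deriv x₁ 0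
        = α₂ • deriv (deriv x₂) 0 + β₂ • deriv x₂ 0) :
    α₁ = α₂ ∧ β₁ = β₂ ∧
    ∀ t ∈ I₁ ∩ I₂,
      x₁ t = x₂ t ∧
      deriv x₁ t = deriv x₂ t ∧
      (α₁ + β₁ * t) • deriv x₁ t = (α₂ + β₂ * t) • deriv x₂ t ∧
      (α₁ + β₁ * t) • deriv (deriv x₁) t + β₁ • deriv x₁ t
        = (α₂ + β₂ * t) • deriv (deriv x₂) t + β₂ • deriv x₂ t := by
  obtain ⟨hx, hv, hα, hβ⟩ := h0
  have hne : deriv x₂ 0 ≠ 0 := hx₂reg 0 h0I₂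
  have hαeq : α₁ = α₂ := smul_left_injective ℝ hne (by simpa only [hv] using hα)
  subst hαeq
  have hacc : deriv (deriv x₁) 0 = deriv (deriv x₂) 0 := by
    rw [hx₁geo 0 h0I₁, hx₂geo 0 h0I₂, hx, hv]
  rw [hacc, hv] at hβ
  have hβeq : β₁ = β₂ := smul_left_injective ℝ hne (add_left_cancel hβ)
  subst hβeq
  refine ⟨rfl, rfl, ?_⟩
  have hU : IsOpen {p : E × E | p.2 ≠ 0} := isOpen_ne_fun continuous_snd continuous_const
  have hV : ContDiffOn ℝ 1 (fun p : E × E => (p.2, (-2 : ℝ) • G p)) {p : E × E | p.2 ≠ 0} :=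
    contDiff_snd.contDiffOn.prodMk ((hGsmooth.of_le (by exact_mod_cast le_top)).const_smul _)
  have hlift : EqOn (fun t => (x₁ t, deriv x₁ t)) (fun t => (x₂ t, deriv x₂ t)) (I₁ ∩ I₂) :=
    eqOn_of_hasDerivAt_of_contDiffOn hU hV (hI₁open.inter hI₂open)
      (hI₁conn.inter hI₂conn).isPreconnected ⟨h0I₁, h0I₂⟩
      (fun t ht => hasDerivAt_prodMk_deriv_of_geodesic hI₁open
        (contDiffOn_infty.mp hx₁smooth 2) hx₁geo ht.1)
      (fun t ht => hx₁reg t ht.1)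
      (fun t ht => hasDerivAt_prodMk_deriv_of_geodesic hI₂open
        (contDiffOn_infty.mp hx₂smooth 2) hx₂geo ht.2)
      (Prod.ext hx hv)
  intro t ht
  obtain ⟨hxt, hvt⟩ := Prod.ext_iff.mp (hlift ht)
  dsimp only at hxt hvt
  refine ⟨hxt, hvt, by rw [hvt], ?_⟩
  rw [hx₁geo t ht.1, hx₂geo t ht.2, hxt, hvt]
end

section
/- Suppose G is smooth on E × (E \ {0}). Let a, b : (-ε, ε) → ℝ be smooth functions, and let x : I × (-ε, ε) → E be a smooth map on an open interval I such that for each s ∈ (-ε, ε) the curve t ↦ x(t, s) is a geodesic of G. Define the variation through geodesics of the sub-spray P by V(t, s) = (x(t, s), ∂_t x(t, s), (a(s) + b(s)·t)·∂_t x(t, s), (a(s) + b(s)·t)·∂_t² x(t, s) + b(s)·∂_t x(t, s)) ∈ E⁴, and set J(t) = ∂_s V(t, s)|_{s=0}. If J(t₀) = 0 for some t₀ ∈ I, then J(t) = 0 for all t ∈ I. In particular, the sub-spray P has no conjugate points: no Jacobi field of P that vanishes at two distinct parameter values can be nonzero. -/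
open Set

/-- A solution of a linear ordinary differential equation with continuous coefficients that
vanishes at one point of an interval vanishes on the whole interval. -/
theorem linear_ode_eq_zero_of_eq_zero_at
    {F : Type*} [NormedAddCommGroup F] [NormedSpace ℝ F]
    {I : Set ℝ} (hI : I.OrdConnected) {A : ℝ → F →L[ℝ] F} (hA : ContinuousOn A I)
    {z : ℝ → F} (hz : ∀ t ∈ I, HasDerivAt z (A t (z t)) t)
    {t₀ : ℝ} (ht₀ : t₀ ∈ I) (hz₀ : z t₀ = 0) : ∀ t ∈ I, z t = 0 := by
  have bound : ∀ c ∈ I, ∀ d ∈ I, ∃ K : NNReal, ∀ t ∈ Icc c d,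
      LipschitzOnWith K (fun y => A t y) univ := by
    intro c hc d hd
    obtain ⟨C, hC⟩ := isCompact_Icc.exists_bound_of_continuousOn (hA.mono (hI.out hc hd))
    refine ⟨C.toNNReal, fun t ht => ((A t).lipschitz.weaken ?_).lipschitzOnWith⟩
    rw [← NNReal.coe_le_coe, coe_nnnorm]
    exact (hC t ht).trans (Real.le_coe_toNNReal C)
  intro t ht
  rcases le_total t₀ t with h | h
  · have hsub := hI.out ht₀ ht
    obtain ⟨K, hK⟩ := bound t₀ ht₀ t ht
    exact ODE_solution_unique_of_mem_Icc_right (v := fun t y => A t y) (s := fun _ => univ)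
      (g := fun _ => 0)
      (fun u hu => hK u (Ico_subset_Icc_self hu))
      (fun u hu => (hz u (hsub hu)).continuousAt.continuousWithinAt)
      (fun u hu => (hz u (hsub (Ico_subset_Icc_self hu))).hasDerivWithinAt)
      (fun _ _ => mem_univ _) continuousOn_const
      (fun u _ => by simpa using hasDerivWithinAt_const u (Ici u) (0 : F))
      (fun _ _ => mem_univ _) hz₀ (right_mem_Icc.2 h)
  · have hsub := hI.out ht ht₀
    obtain ⟨K, hK⟩ := bound t ht t₀ ht₀
    exact ODE_solution_unique_of_mem_Icc_left (v := fun t y => A t y) (s := fun _ => univ)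
      (g := fun _ => 0)
      (fun u hu => hK u (Ioc_subset_Icc_self hu))
      (fun u hu => (hz u (hsub hu)).continuousAt.continuousWithinAt)
      (fun u hu => (hz u (hsub (Ioc_subset_Icc_self hu))).hasDerivWithinAt)
      (fun _ _ => mem_univ _) continuousOn_const
      (fun u _ => by simpa using hasDerivWithinAt_const u (Iic u) (0 : F))
      (fun _ _ => mem_univ _) hz₀ (left_mem_Icc.2 h)

/-- A directional derivative of a smooth function on an open set is smooth. -/
theorem contDiffOn_fderiv_apply
    {E F : Type*} [NormedAddCommGroup E] [NormedSpace ℝ E]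
    [NormedAddCommGroup F] [NormedSpace ℝ F] {U : Set E} (hU : IsOpen U) {g : E → F}
    (hg : ContDiffOn ℝ (⊤ : ℕ∞) g U) (v : E) :
    ContDiffOn ℝ (⊤ : ℕ∞) (fun p => fderiv ℝ g p v) U :=
  (hg.fderiv_of_isOpen hU (by simp)).clm_apply contDiffOn_const

/-- Directional derivatives of a smooth function on an open set commute. -/
theorem fderiv_fderiv_apply_comm
    {E F : Type*} [NormedAddCommGroup E] [NormedSpace ℝ E]
    [NormedAddCommGroup F] [NormedSpace ℝ F] {U : Set E} (hU : IsOpen U) {g : E → F}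
    (hg : ContDiffOn ℝ (⊤ : ℕ∞) g U) {p : E} (hp : p ∈ U) (v w : E) :
    fderiv ℝ (fun q => fderiv ℝ g q v) p w = fderiv ℝ (fun q => fderiv ℝ g q w) p v := by
  have hd : DifferentiableAt ℝ (fderiv ℝ g) p :=
    ((hg.fderiv_of_isOpen hU (m := (⊤ : ℕ∞)) (by simp)).contDiffAt
      (hU.mem_nhds hp)).differentiableAt (by simp)
  have hsymm : IsSymmSndFDerivAt ℝ g p :=
    (hg.contDiffAt (hU.mem_nhds hp)).isSymmSndFDerivAt
      (by simpa using WithTop.coe_le_coe.2 (le_top : (2 : ℕ∞) ≤ ⊤))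
  have key : ∀ u, fderiv ℝ (fun q => fderiv ℝ g q u) p =
      (fderiv ℝ (fderiv ℝ g) p).flip u := by
    intro u
    simpa using fderiv_clm_apply hd (differentiableAt_const u)
  rw [key, key]
  exact hsymm w v

/-- The first-variable slice of a function differentiable at `(t, s)`. -/
theorem DifferentiableAt.hasDerivAt_slice_left
    {F : Type*} [NormedAddCommGroup F] [NormedSpace ℝ F] {g : ℝ × ℝ → F} {t s : ℝ}
    (hg : DifferentiableAt ℝ g (t, s)) :
    HasDerivAt (fun u => g (u, s)) (fderiv ℝ g (t, s) (1, 0)) t :=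
  hg.hasFDerivAt.comp_hasDerivAt t ((hasDerivAt_id t).prodMk (hasDerivAt_const t s))

/-- The second-variable slice of a function differentiable at `(t, s)`. -/
theorem DifferentiableAt.hasDerivAt_slice_right
    {F : Type*} [NormedAddCommGroup F] [NormedSpace ℝ F] {g : ℝ × ℝ → F} {t s : ℝ}
    (hg : DifferentiableAt ℝ g (t, s)) :
    HasDerivAt (fun u => g (t, u)) (fderiv ℝ g (t, s) (0, 1)) s :=
  hg.hasFDerivAt.comp_hasDerivAt s ((hasDerivAt_const s t).prodMk (hasDerivAt_id s))

/-- (The sub-spray `P` has no conjugate points.)  Suppose `G` is smooth on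
`E × (E \ {0})`.  Let `a, b : (-ε, ε) → ℝ` be smooth, let `x : I × (-ε, ε) → E` be a smooth
map whose `s`-slices are geodesics of `G`, and define the variation through geodesics of `P`
`V(t, s) = (x, ∂ₜx, (a(s) + b(s)·t)·∂ₜx, (a(s) + b(s)·t)·∂ₜ²x + b(s)·∂ₜx)` with Jacobi field
`J(t) = ∂ₛ V(t, s)|₀`.  If `J(t₀) = 0` for some `t₀ ∈ I`, then `J ≡ 0` on `I`.  In particular
no Jacobi field of `P` vanishing at two distinct parameter values can be nonzero: `P` has no
conjugate points. -/
theorem subspray_has_no_conjugate_points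
    {E : Type*} [NormedAddCommGroup E] [NormedSpace ℝ E] [FiniteDimensional ℝ E] [Nontrivial E]
    (G : E × E → E)
    (hGsmooth : ContDiffOn ℝ (⊤ : ℕ∞) G {p : E × E | p.2 ≠ 0})
    (hGhom : ∀ (x y : E) (l : ℝ), 0 < l → y ≠ 0 → G (x, l • y) = l ^ 2 • G (x, y))
    (I : Set ℝ) (hIopen : IsOpen I) (hIconn : I.OrdConnected)
    (ε : ℝ) (hε : 0 < ε)
    (a b : ℝ → ℝ)
    (hasmooth : ContDiffOn ℝ (⊤ : ℕ∞) a (Ioo (-ε) ε))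
    (hbsmooth : ContDiffOn ℝ (⊤ : ℕ∞) b (Ioo (-ε) ε))
    (x : ℝ → ℝ → E)
    (hxsmooth : ContDiffOn ℝ (⊤ : ℕ∞) (fun p : ℝ × ℝ => x p.1 p.2) (I ×ˢ Ioo (-ε) ε))
    (hxgeo : ∀ s ∈ Ioo (-ε) ε, ∀ t ∈ I,
      deriv (fun u => x u s) t ≠ 0 ∧
      deriv (deriv (fun u => x u s)) t = (-2 : ℝ) • G (x t s, deriv (fun u => x u s) t))
    (V : ℝ → ℝ → E × E × E × E)
    (hV : ∀ t s, V t s =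
      (x t s,
       deriv (fun u => x u s) t,
       (a s + b s * t) • deriv (fun u => x u s) t,
       (a s + b s * t) • deriv (deriv (fun u => x u s)) t
         + b s • deriv (fun u => x u s) t))
    (J : ℝ → E × E × E × E)
    (hJ : ∀ t, J t = deriv (fun s => V t s) 0)
    (t₀ : ℝ) (ht₀ : t₀ ∈ I) (hJt₀ : J t₀ = 0) :
    ∀ t ∈ I, J t = 0 := by
  have hU : IsOpen (I ×ˢ Ioo (-ε) ε) := hIopen.prod isOpen_Ioo
  set U : Set (ℝ × ℝ) := I ×ˢ Ioo (-ε) ε with hUdef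
  set F : ℝ × ℝ → E := fun p => x p.1 p.2 with hF
  set X₁ : ℝ × ℝ → E := fun p => fderiv ℝ F p (1, 0) with hX₁
  set X₂ : ℝ × ℝ → E := fun p => fderiv ℝ X₁ p (1, 0) with hX₂
  have hX₁smooth : ContDiffOn ℝ (⊤ : ℕ∞) X₁ U := contDiffOn_fderiv_apply hU hxsmooth _
  have hX₂smooth : ContDiffOn ℝ (⊤ : ℕ∞) X₂ U := contDiffOn_fderiv_apply hU hX₁smooth _
  have diff {H : Type _} [NormedAddCommGroup H] [NormedSpace ℝ H] {g : ℝ × ℝ → H}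
      (hg : ContDiffOn ℝ (⊤ : ℕ∞) g U) {p : ℝ × ℝ} (hp : p ∈ U) : DifferentiableAt ℝ g p :=
    (hg.contDiffAt (hU.mem_nhds hp)).differentiableAt (by simp)
  have zero_mem : (0 : ℝ) ∈ Ioo (-ε) ε := ⟨by linarith, hε⟩
  have hd₁ : ∀ t ∈ I, ∀ s ∈ Ioo (-ε) ε, deriv (fun u => x u s) t = X₁ (t, s) :=
    fun t ht s hs => (diff hxsmooth (mk_mem_prod ht hs)).hasDerivAt_slice_left.deriv
  have hd₂ : ∀ t ∈ I, ∀ s ∈ Ioo (-ε) ε,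
      deriv (deriv (fun u => x u s)) t = X₂ (t, s) := by
    intro t ht s hs
    have heq : deriv (fun u => x u s) =ᶠ[nhds t] fun u => X₁ (u, s) :=
      Filter.eventually_of_mem (hIopen.mem_nhds ht) fun u hu => hd₁ u hu s hs
    rw [heq.deriv_eq]
    exact (diff hX₁smooth (mk_mem_prod ht hs)).hasDerivAt_slice_left.deriv
  have hne : ∀ p ∈ U, X₁ p ≠ 0 := fun p hp =>
    hd₁ p.1 hp.1 p.2 hp.2 ▸ (hxgeo p.2 hp.2 p.1 hp.1).1
  have hspray : ∀ p ∈ U, X₂ p = (-2 : ℝ) • G (F p, X₁ p) := fun p hp => by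
    have h := (hxgeo p.2 hp.2 p.1 hp.1).2
    rwa [hd₂ p.1 hp.1 p.2 hp.2, hd₁ p.1 hp.1 p.2 hp.2] at h
  have hslit : IsOpen {p : E × E | p.2 ≠ 0} := isOpen_ne_fun continuous_snd continuous_const
  have hJeq : ∀ t ∈ I, J t =
      (fderiv ℝ F (t, 0) (0, 1),
       fderiv ℝ X₁ (t, 0) (0, 1),
       (a 0 + b 0 * t) • fderiv ℝ X₁ (t, 0) (0, 1) + (deriv a 0 + deriv b 0 * t) • X₁ (t, 0),
       (a 0 + b 0 * t) • fderiv ℝ X₂ (t, 0) (0, 1) + (deriv a 0 + deriv b 0 * t) • X₂ (t, 0)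
         + (b 0 • fderiv ℝ X₁ (t, 0) (0, 1) + deriv b 0 • X₁ (t, 0))) := by
    intro t ht
    have hp : (t, (0 : ℝ)) ∈ U := mk_mem_prod ht zero_mem
    have hnhds : Ioo (-ε) ε ∈ nhds (0 : ℝ) := isOpen_Ioo.mem_nhds zero_mem
    have ha := ((hasmooth.contDiffAt hnhds).differentiableAt (by simp)).hasDerivAt
    have hb := ((hbsmooth.contDiffAt hnhds).differentiableAt (by simp)).hasDerivAt
    have hab := ha.add (hb.mul_const t)
    have h₀ := (diff hxsmooth hp).hasDerivAt_slice_right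
    have h₁ := (diff hX₁smooth hp).hasDerivAt_slice_right
    have h₂ := (diff hX₂smooth hp).hasDerivAt_slice_right
    have heq : (fun s => V t s) =ᶠ[nhds 0] fun s =>
        (F (t, s), X₁ (t, s), (a s + b s * t) • X₁ (t, s),
          (a s + b s * t) • X₂ (t, s) + b s • X₁ (t, s)) :=
      Filter.eventually_of_mem hnhds fun s hs => by
        simp only [hV, hd₁ t ht s hs, hd₂ t ht s hs, hF]
    rw [hJ, heq.deriv_eq]
    exact (h₀.prodMk (h₁.prodMk ((hab.smul h₁).prodMk
      ((hab.smul h₂).add (hb.smul h₁))))).deriv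
  have hfd₂ : ∀ t ∈ I, fderiv ℝ X₂ (t, 0) (0, 1) =
      (-2 : ℝ) • fderiv ℝ G (F (t, 0), X₁ (t, 0))
        (fderiv ℝ F (t, 0) (0, 1), fderiv ℝ X₁ (t, 0) (0, 1)) := by
    intro t ht
    have hp : (t, (0 : ℝ)) ∈ U := mk_mem_prod ht zero_mem
    have hG : DifferentiableAt ℝ G (F (t, 0), X₁ (t, 0)) :=
      (hGsmooth.contDiffAt (hslit.mem_nhds (hne _ hp))).differentiableAt (by simp)
    have heq : X₂ =ᶠ[nhds (t, (0 : ℝ))] fun p => (-2 : ℝ) • G (F p, X₁ p) :=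
      Filter.eventually_of_mem (hU.mem_nhds hp) hspray
    have hcomp := (hG.hasFDerivAt.comp (t, (0 : ℝ))
      ((diff hxsmooth hp).hasFDerivAt.prodMk (diff hX₁smooth hp).hasFDerivAt)).const_smul (-2 : ℝ)
    rw [heq.fderiv_eq, show fderiv ℝ (fun p => (-2 : ℝ) • G (F p, X₁ p)) (t, 0) = _ from
      hcomp.fderiv]
    rfl
  have hcurve : ContinuousOn (fun t : ℝ => (t, (0 : ℝ))) I := by fun_prop
  have hmaps : MapsTo (fun t : ℝ => (t, (0 : ℝ))) I U := fun t ht => mk_mem_prod ht zero_mem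
  have hDG : ContinuousOn (fun t => fderiv ℝ G (F (t, 0), X₁ (t, 0))) I :=
    (hGsmooth.continuousOn_fderiv_of_isOpen hslit (by simp)).comp
      ((hxsmooth.continuousOn.comp hcurve hmaps).prodMk
        (hX₁smooth.continuousOn.comp hcurve hmaps)) fun t ht => hne _ (hmaps ht)
  have hA : ContinuousOn (fun t => (ContinuousLinearMap.snd ℝ E E).prod
      ((-2 : ℝ) • fderiv ℝ G (F (t, 0), X₁ (t, 0)))) I :=
    (ContinuousLinearMap.prodₗᵢ (𝕜 := ℝ) (E := E × E) (F := E) (G := E)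
      ℝ).continuous.comp_continuousOn (continuousOn_const.prodMk (hDG.const_smul (-2 : ℝ)))
  have hode : ∀ t ∈ I, (fderiv ℝ F (t, 0) (0, 1), fderiv ℝ X₁ (t, 0) (0, 1)) = (0 : E × E) := by
    refine linear_ode_eq_zero_of_eq_zero_at hIconn hA (fun t ht => ?_) ht₀ ?_
    · have hp := hmaps ht
      have h₀ := (diff (contDiffOn_fderiv_apply hU hxsmooth (0, 1)) hp).hasDerivAt_slice_left
      have h₁ := (diff (contDiffOn_fderiv_apply hU hX₁smooth (0, 1)) hp).hasDerivAt_slice_left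
      rw [fderiv_fderiv_apply_comm hU hxsmooth hp] at h₀
      rw [fderiv_fderiv_apply_comm hU hX₁smooth hp] at h₁
      have h := h₀.prodMk h₁
      rw [show fderiv ℝ (fun q => fderiv ℝ X₁ q (1, 0)) (t, 0) (0, 1) = _ from hfd₂ t ht] at h
      exact h
    · have h := (hJeq t₀ ht₀).symm.trans hJt₀
      simp only [Prod.mk_eq_zero] at h ⊢
      exact ⟨h.1, h.2.1⟩
  have hw : ∀ t ∈ I, fderiv ℝ F (t, 0) (0, 1) = 0 ∧ fderiv ℝ X₁ (t, 0) (0, 1) = 0 :=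
    fun t ht => by simpa only [Prod.mk_eq_zero] using hode t ht
  have hw₂ : ∀ t ∈ I, fderiv ℝ X₂ (t, 0) (0, 1) = 0 := fun t ht => by
    rw [hfd₂ t ht, hode t ht, map_zero, smul_zero]
  have h := (hJeq t₀ ht₀).symm.trans hJt₀
  have hne₀ := hne _ (hmaps ht₀)
  simp only [Prod.mk_eq_zero, (hw t₀ ht₀).2, hw₂ t₀ ht₀, smul_zero, zero_add] at h
  have hab : deriv a 0 + deriv b 0 * t₀ = 0 := (smul_eq_zero.1 h.2.2.1).resolve_right hne₀
  have hb : deriv b 0 = 0 := by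
    have h₄ := h.2.2.2
    rw [hab, zero_smul, zero_add] at h₄
    exact (smul_eq_zero.1 h₄).resolve_right hne₀
  have ha : deriv a 0 = 0 := by simpa [hb] using hab
  intro t ht
  simp [hJeq t ht, (hw t ht).1, (hw t ht).2, hw₂ t ht, ha, hb]
end
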